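/- arXiv:1209.4215 — 3 statements merged into one kernel-verified Lean document; each statement's English description precedes it below -/
import Mathlib

section
/- Let A be a noetherian ring whose global dimension is at most n, let e ∈ A be an idempotent, and let E = eAe. Assume that Ext^i_E(eA, E) = 0 for all i > 0 (Ext taken in left E-modules) and Ext^i_{E^op}(Ae, E) = 0 for all i > 0 (Ext taken in right E-modules). Then E is a noetherian ring satisfying inj.dim_E E ≤ n and inj.dim E_E ≤ n; that is, E is an Iwanaga–Gorenstein ring of dimension at most n. -/
set_option maxHeartbeats 1000000 in
def Corner {A : Type} [Ring A] (e : A) (_he : IsIdempotentElem e) : Type :=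
  {x : A // e * x = x ∧ x * e = x}

namespace Corner

variable {A : Type} [Ring A] {e : A} {he : IsIdempotentElem e}

set_option maxHeartbeats 1000000 in
instance : Ring (Corner e he) where
  add x y := ⟨x.1 + y.1, by rw [mul_add, x.2.1, y.2.1], by rw [add_mul, x.2.2, y.2.2]⟩
  add_assoc x y z := Subtype.ext (add_assoc _ _ _)
  zero := ⟨0, by simp, by simp⟩
  zero_add x := Subtype.ext (zero_add _)
  add_zero x := Subtype.ext (add_zero _)
  add_comm x y := Subtype.ext (add_comm _ _)
  mul x y := ⟨x.1 * y.1, by rw [← mul_assoc, x.2.1], by rw [mul_assoc, y.2.2]⟩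
  left_distrib x y z := Subtype.ext (mul_add _ _ _)
  right_distrib x y z := Subtype.ext (add_mul _ _ _)
  zero_mul x := Subtype.ext (zero_mul _)
  mul_zero x := Subtype.ext (mul_zero _)
  mul_assoc x y z := Subtype.ext (mul_assoc _ _ _)
  one := ⟨e, he, he⟩
  one_mul x := Subtype.ext x.2.1
  mul_one x := Subtype.ext x.2.2
  neg x := ⟨-x.1, by rw [mul_neg, x.2.1], by rw [neg_mul, x.2.2]⟩
  neg_add_cancel x := Subtype.ext (neg_add_cancel _)
  nsmul n x := ⟨n • x.1, by rw [mul_smul_comm, x.2.1], by rw [smul_mul_assoc, x.2.2]⟩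
  nsmul_zero x := Subtype.ext (zero_nsmul _)
  nsmul_succ n x := Subtype.ext (succ_nsmul _ _)
  zsmul n x := ⟨n • x.1, by rw [mul_smul_comm, x.2.1], by rw [smul_mul_assoc, x.2.2]⟩
  zsmul_zero' x := Subtype.ext (zero_zsmul _)
  zsmul_succ' n x := Subtype.ext
    (show ((n.succ : ℕ) : ℤ) • x.1 = ((n : ℕ) : ℤ) • x.1 + x.1 by
      push_cast; rw [add_zsmul, one_zsmul])
  zsmul_neg' n x := Subtype.ext
    (show (Int.negSucc n) • x.1 = -(((n.succ : ℕ) : ℤ) • x.1) by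
      rw [negSucc_zsmul, natCast_zsmul])
  natCast n := ⟨n • e, by rw [mul_smul_comm, he.eq], by rw [smul_mul_assoc, he.eq]⟩
  natCast_zero := Subtype.ext (zero_nsmul _)
  natCast_succ n := Subtype.ext (succ_nsmul _ _)
  intCast n := ⟨n • e, by rw [mul_smul_comm, he.eq], by rw [smul_mul_assoc, he.eq]⟩
  intCast_ofNat n := Subtype.ext (natCast_zsmul _ _)
  intCast_negSucc n := Subtype.ext (negSucc_zsmul _ _)

end Corner

def eASubgroup (A : Type) [Ring A] (e : A) : AddSubgroup A where
  carrier := {a : A | e * a = a}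
  add_mem' := by intro a b ha hb; simp only [Set.mem_setOf_eq] at *; rw [mul_add, ha, hb]
  zero_mem' := by simp
  neg_mem' := by intro a ha; simp only [Set.mem_setOf_eq] at *; rw [mul_neg, ha]

instance eASubgroup.instModule {A : Type} [Ring A] {e : A} {he : IsIdempotentElem e} :
    Module (Corner e he) (eASubgroup A e) where
  smul x a := ⟨x.1 * a.1, show e * (x.1 * a.1) = x.1 * a.1 by rw [← mul_assoc, x.2.1]⟩
  one_smul a := Subtype.ext (show e * a.1 = a.1 from a.2)
  mul_smul x y a := Subtype.ext (mul_assoc _ _ _)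
  smul_zero x := Subtype.ext (mul_zero _)
  smul_add x a b := Subtype.ext (mul_add _ _ _)
  add_smul x y a := Subtype.ext (add_mul _ _ _)
  zero_smul a := Subtype.ext (zero_mul _)

def AeSubgroup (A : Type) [Ring A] (e : A) : AddSubgroup A where
  carrier := {a : A | a * e = a}
  add_mem' := by intro a b ha hb; simp only [Set.mem_setOf_eq] at *; rw [add_mul, ha, hb]
  zero_mem' := by simp
  neg_mem' := by intro a ha; simp only [Set.mem_setOf_eq] at *; rw [neg_mul, ha]

instance AeSubgroup.instModule {A : Type} [Ring A] {e : A} {he : IsIdempotentElem e} :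
    Module (Corner e he)ᵐᵒᵖ (AeSubgroup A e) where
  smul x a := ⟨a.1 * x.unop.1,
    show (a.1 * x.unop.1) * e = a.1 * x.unop.1 by rw [mul_assoc, x.unop.2.2]⟩
  one_smul a := Subtype.ext (show a.1 * e = a.1 from a.2)
  mul_smul x y a := Subtype.ext (mul_assoc _ _ _).symm
  smul_zero x := Subtype.ext (zero_mul _)
  smul_add x a b := Subtype.ext (add_mul _ _ _)
  add_smul x y a := Subtype.ext (mul_add _ _ _)
  zero_smul a := Subtype.ext (mul_zero _)

open CategoryTheory

/-- The `i`-th Ext group of two left modules over a (possibly noncommutative) ring `Γ`,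
computed in the abelian category of left `Γ`-modules. -/
noncomputable def extGroup (Γ : Type) [Ring Γ] (n : ℕ) (X Y : ModuleCat Γ) : ModuleCat ℤ :=
  ((Ext ℤ (ModuleCat Γ) n).obj (Opposite.op X)).obj Y

/-- A left `A`-module `M` has projective dimension at most `n` if it admits a projective
resolution which vanishes in degrees `> n`. -/
def hasProjDimLE (A : Type) [Ring A] (M : ModuleCat A) (n : ℕ) : Prop :=
  ∃ P : ProjectiveResolution M, ∀ k, n < k → Limits.IsZero (P.complex.X k)

/-- A left `A`-module `M` has injective dimension at most `n` if it admits an injective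
resolution which vanishes in degrees `> n`. -/
def hasInjDimLE (A : Type) [Ring A] (M : ModuleCat A) (n : ℕ) : Prop :=
  ∃ I : InjectiveResolution M, ∀ k, n < k → Limits.IsZero (I.cocomplex.X k)

section Part1
open Limits

theorem exists_injRes {C : Type*} [Category C] [Abelian C] [EnoughInjectives C] (n : ℕ) :
    ∀ (X : C), HasInjectiveDimensionLT X (n + 1) →
      ∃ I : InjectiveResolution X, ∀ k, n < k → IsZero (I.cocomplex.X k) := by
  induction n with
  | zero =>
    intro X hX
    have : Injective X := injective_iff_hasInjectiveDimensionLT_one.2 hX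
    refine ⟨InjectiveResolution.self X, fun k hk => ?_⟩
    exact HomologicalComplex.isZero_single_obj_X _ _ _ _ (by simpa using hk.ne')
  | succ n ih =>
    intro X hX
    obtain ⟨p⟩ := EnoughInjectives.presentation X
    have hS : (ShortComplex.mk p.f (cokernel.π p.f) (cokernel.condition p.f)).ShortExact :=
      { exact := ShortComplex.exact_cokernel p.f }
    have h3 := (hS.hasInjectiveDimensionLT_X₃_iff n p.injective).2 hX
    obtain ⟨J, hJ⟩ := ih _ h3
    have hmono : Mono (J.ι.f 0) := inferInstance
    let j : cokernel p.f ⟶ J.cocomplex.X 0 := J.ι.f 0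
    have hjm : Mono j := hmono
    have hj : j ≫ J.cocomplex.d 0 1 = 0 := J.ι_f_zero_comp_complex_d
    have hjl : (ShortComplex.mk j (J.cocomplex.d 0 1) hj).Exact :=
      ShortComplex.exact_of_f_is_kernel _ J.isLimitKernelFork
    let K := CochainComplex.augment J.cocomplex (cokernel.π p.f ≫ j)
      (by rw [Category.assoc, hj, comp_zero])
    have hd01 : K.d 0 1 = cokernel.π p.f ≫ j := rfl
    have hd12 : K.d 1 2 = J.cocomplex.d 0 1 := rfl
    have hw : p.f ≫ cokernel.π p.f ≫ j = 0 := by rw [cokernel.condition_assoc, zero_comp]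
    refine ⟨{ cocomplex := K
              injective := ?_
              ι := (CochainComplex.fromSingle₀Equiv _ _).symm ⟨p.f, ?_⟩
              quasiIso := ⟨fun k => ?_⟩ }, ?_⟩
    · rintro (_ | k)
      · exact p.injective
      · exact J.injective k
    · exact hw
    · rcases k with _ | k
      · rw [CochainComplex.quasiIsoAt₀_iff, ShortComplex.quasiIso_iff_of_zeros]
        · have h1 : (ShortComplex.mk p.f (cokernel.π p.f ≫ j) hw).Exact :=
            (ShortComplex.exact_iff_of_epi_of_isIso_of_mono
              (S₁ := ShortComplex.mk p.f (cokernel.π p.f) (cokernel.condition p.f))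
              (S₂ := ShortComplex.mk p.f (cokernel.π p.f ≫ j) hw)
              { τ₁ := 𝟙 _, τ₂ := 𝟙 _, τ₃ := j }).1 hS.exact
          refine (ShortComplex.exact_and_mono_f_iff_of_iso ?_).2 ⟨h1, p.mono⟩
          exact ShortComplex.isoMk (Iso.refl _) (Iso.refl _) (Iso.refl _)
            ((Category.id_comp _).trans ((CochainComplex.fromSingle₀Equiv_symm_apply_f_zero
              (C := K) p.f hw).symm.trans (Category.comp_id _).symm))
            ((Category.id_comp _).trans (Category.comp_id _).symm)
        all_goals rfl
      · rw [quasiIsoAt_iff_exactAt]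
        · rw [HomologicalComplex.exactAt_iff' _ k (k+1) (k+2) (by simp) (by simp)]
          rcases k with _ | k
          · exact (ShortComplex.exact_iff_of_epi_of_isIso_of_mono
              (S₂ := ShortComplex.mk j (J.cocomplex.d 0 1) hj)
              (S₁ := ShortComplex.mk (cokernel.π p.f ≫ j) (J.cocomplex.d 0 1)
                (by rw [Category.assoc, hj, comp_zero]))
              { τ₁ := cokernel.π p.f, τ₂ := 𝟙 _, τ₃ := 𝟙 _ }).2 hjl
          · exact J.exact_succ k
        · apply CochainComplex.exactAt_succ_single_obj
    · rintro (_ | k) hk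
      · omega
      · exact hJ k (by omega)
end Part1

section Part2
open Limits

theorem injDim_of_baer {E : Type} [Ring E] (n : ℕ) : ∀ (Y : ModuleCat.{0} E),
    (∀ I : Ideal E, Subsingleton (Abelian.Ext (ModuleCat.of E (E ⧸ I)) Y (n + 1))) →
    HasInjectiveDimensionLT Y (n + 1) := by
  induction n with
  | zero =>
    intro Y h
    rw [← injective_iff_hasInjectiveDimensionLT_one]
    rw [← Module.injective_iff_injective_object]
    refine Module.Baer.injective ?_
    intro I g
    let S : ShortComplex (ModuleCat.{0} E) :=
      ModuleCat.shortComplexOfCompEqZero I.subtype I.mkQ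
        (by ext x; simp)
    have hS : S.ShortExact := ModuleCat.shortComplex_shortExact S
      (by exact LinearMap.exact_subtype_mkQ I) Subtype.val_injective (Submodule.mkQ_surjective _)
    have := h I
    obtain ⟨x, hx⟩ := Abelian.Ext.contravariant_sequence_exact₁ hS Y
      (Abelian.Ext.mk₀ (ModuleCat.ofHom g) : Abelian.Ext S.X₁ Y 0) (n₁ := 1) rfl
      (Subsingleton.elim (α := Abelian.Ext (ModuleCat.of E (E ⧸ I)) Y 1) _ _)
    obtain ⟨f, rfl⟩ := (Abelian.Ext.mk₀_bijective _ _).2 x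
    rw [Abelian.Ext.mk₀_comp_mk₀] at hx
    have := (Abelian.Ext.mk₀_bijective _ _).1 hx
    refine ⟨f.hom, fun x hx => ?_⟩
    exact congrArg (fun t => t.hom ⟨x, hx⟩) this
  | succ n ih =>
    intro Y h
    obtain ⟨p⟩ := EnoughInjectives.presentation Y
    have hS : (ShortComplex.mk p.f (cokernel.π p.f) (cokernel.condition p.f)).ShortExact :=
      { exact := ShortComplex.exact_cokernel p.f }
    refine (hS.hasInjectiveDimensionLT_X₃_iff n p.injective).1 (ih _ fun I => ?_)
    have := h I
    refine ⟨fun a b => ?_⟩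
    suffices H : ∀ a : Abelian.Ext (ModuleCat.of E (E ⧸ I)) (cokernel p.f) (n + 1), a = 0 from
      (H a).trans (H b).symm
    intro a
    obtain ⟨x, rfl⟩ := Abelian.Ext.covariant_sequence_exact₃ _ hS a rfl
      (Subsingleton.elim (α := Abelian.Ext (ModuleCat.of E (E ⧸ I)) Y (n+1+1)) _ _)
    have : Injective (ShortComplex.mk p.f (cokernel.π p.f) (cokernel.condition p.f)).X₂ := p.injective
    rw [Abelian.Ext.eq_zero_of_injective x, Abelian.Ext.zero_comp]

theorem ext_subsingleton_of_extGroup {Γ : Type} [Ring Γ] (i : ℕ) (hi : 0 < i)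
    (X Y : ModuleCat.{0} Γ) (h : Subsingleton (extGroup Γ i X Y)) :
    Subsingleton (Abelian.Ext X Y i) := by
  obtain ⟨p, rfl⟩ : ∃ p, i = p + 1 := ⟨i - 1, by omega⟩
  let P := projectiveResolution X
  have h0 : IsZero (extGroup Γ (p+1) X Y) := ModuleCat.isZero_of_subsingleton _
  have h1 := h0.of_iso (P.isoExt (R := ℤ) (p+1) Y).symm
  rw [← HomologicalComplex.exactAt_iff_isZero_homology,
    HomologicalComplex.exactAt_iff' _ p (p+1) (p+2) (by simp) (by simp)] at h1
  rw [ShortComplex.moduleCat_exact_iff] at h1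
  suffices H : ∀ a : Abelian.Ext X Y (p+1), a = 0 from ⟨fun a b => (H a).trans (H b).symm⟩
  intro a
  obtain ⟨f, hf, rfl⟩ := P.extMk_surjective a (p+2) rfl
  rw [P.extMk_eq_zero_iff f (p+2) rfl hf p rfl]
  obtain ⟨g, hg⟩ := h1 f hf
  exact ⟨g, hg⟩

theorem projDim_of_hasProjDimLE {A : Type} [Ring A] (M : ModuleCat.{0} A) (n : ℕ)
    (h : hasProjDimLE A M n) : HasProjectiveDimensionLT M (n + 1) := by
  obtain ⟨P, hP⟩ := h
  rw [hasProjectiveDimensionLT_iff]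
  intro i hi Y a
  obtain ⟨f, hf, rfl⟩ := P.extMk_surjective a (i+1) rfl
  obtain rfl : f = 0 := (hP i (by omega)).eq_of_src _ _
  simp

theorem ext_zero_of_sum {E : Type} [Ring E] {ι : Type*} [Fintype ι] {X Z Y : ModuleCat.{0} E}
    (p : ι → (X ⟶ Z)) (q : ι → (Z ⟶ X)) (hpq : ∑ i, p i ≫ q i = 𝟙 X) (j : ℕ)
    (h : Subsingleton (Abelian.Ext Z Y j)) : Subsingleton (Abelian.Ext X Y j) := by
  suffices H : ∀ a : Abelian.Ext X Y j, a = 0 from ⟨fun a b => (H a).trans (H b).symm⟩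
  intro a
  have h1 : (Abelian.Ext.mk₀ (𝟙 X)).comp a (zero_add j) = a := by simp
  rw [← h1, ← hpq, Abelian.Ext.mk₀_sum, Abelian.Ext.sum_comp]
  refine Finset.sum_eq_zero fun i _ => ?_
  rw [← Abelian.Ext.mk₀_comp_mk₀, Abelian.Ext.comp_assoc _ _ _ (zero_add 0) (zero_add j) (by omega),
    Subsingleton.elim ((Abelian.Ext.mk₀ (q i)).comp a (zero_add j)) 0, Abelian.Ext.comp_zero]
end Part2

section Part3
open MulOpposite Matrix

variable {A : Type} [Ring A]

/-- row vector with entries in a right module times a matrix -/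
def vm {W : Type} [AddCommGroup W] [Module Aᵐᵒᵖ W] {m k : ℕ} (w : Fin m → W)
    (D : Matrix (Fin m) (Fin k) A) : Fin k → W := fun j => ∑ i, op (D i j) • w i

section
variable {W V : Type} [AddCommGroup W] [Module Aᵐᵒᵖ W] [AddCommGroup V] [Module Aᵐᵒᵖ V]
  {m k l : ℕ}

theorem vm_vm (w : Fin m → W) (D : Matrix (Fin m) (Fin k) A) (D' : Matrix (Fin k) (Fin l) A) :
    vm (vm w D) D' = vm w (D * D') := by
  funext j
  change ∑ i, op (D' i j) • (∑ i', op (D i' i) • w i') = ∑ i', op ((D * D') i' j) • w i'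
  simp only [Matrix.mul_apply, Finset.smul_sum, Finset.op_sum, Finset.sum_smul,
    MulOpposite.op_mul, SemigroupAction.mul_smul]
  rw [Finset.sum_comm]

theorem vm_one (w : Fin m → W) : vm w (1 : Matrix (Fin m) (Fin m) A) = w := by
  funext j
  simp only [vm, Matrix.one_apply]
  rw [Finset.sum_eq_single j]
  · simp
  · intro i _ hi; simp [hi]
  · simp

theorem vm_zero_right (w : Fin m → W) : vm w (0 : Matrix (Fin m) (Fin k) A) = 0 := by
  funext j; simp [vm]

theorem vm_zero_left (D : Matrix (Fin m) (Fin k) A) : vm (0 : Fin m → W) D = 0 := by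
  funext j; simp [vm]

theorem vm_add_right (w : Fin m → W) (D D' : Matrix (Fin m) (Fin k) A) :
    vm w (D + D') = vm w D + vm w D' := by
  funext j; simp [vm, add_smul, Finset.sum_add_distrib]

theorem vm_sub_left (w w' : Fin m → W) (D : Matrix (Fin m) (Fin k) A) :
    vm (w - w') D = vm w D - vm w' D := by
  funext j; simp [vm, smul_sub, Finset.sum_sub_distrib]

theorem vm_map (f : W →ₗ[Aᵐᵒᵖ] V) (w : Fin m → W) (D : Matrix (Fin m) (Fin k) A) :
    vm (fun i => f (w i)) D = fun j => f (vm w D j) := by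
  funext j; simp [vm]
end

/-- left-exactness of a pair of matrices acting on row vectors. -/
structure LEx {m k l : ℕ} (D' : Matrix (Fin l) (Fin m) A) (D : Matrix (Fin m) (Fin k) A) :
    Prop where
  zero : D' * D = 0
  ex : ∀ v : Fin m → A, v ᵥ* D = 0 → ∃ u, v = u ᵥ* D'

theorem exists_LEx [IsNoetherianRing A] {m k : ℕ} (D : Matrix (Fin m) (Fin k) A) :
    ∃ (l : ℕ) (D' : Matrix (Fin l) (Fin m) A), LEx D' D := by
  obtain ⟨l, s, hs⟩ := Submodule.fg_iff_exists_fin_generating_family.1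
    (IsNoetherian.noetherian (LinearMap.ker D.vecMulLinear))
  refine ⟨l, Matrix.of s, ?_, ?_⟩
  · ext i j
    have : s i ∈ LinearMap.ker D.vecMulLinear := hs ▸ Submodule.subset_span ⟨i, rfl⟩
    have := congrFun (LinearMap.mem_ker.1 this) j
    simpa [Matrix.mul_apply, Matrix.vecMul, dotProduct] using this
  · intro v hv
    have : v ∈ LinearMap.ker D.vecMulLinear := hv
    rw [← hs, show Set.range s = Set.range (Matrix.of s).row from rfl,
      ← _root_.range_vecMulLinear] at this
    obtain ⟨u, hu⟩ := this
    exact ⟨u, hu.symm⟩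

/-- `W` has vanishing "Tor" against every module with projective dimension at most `d`. -/
def TorVan (A : Type) [Ring A] (d : ℕ) (W : Type) [AddCommGroup W] [Module Aᵐᵒᵖ W] : Prop :=
  ∀ (m k l : ℕ) (D' : Matrix (Fin l) (Fin m) A) (D : Matrix (Fin m) (Fin k) A), LEx D' D →
    HasProjectiveDimensionLT
      (ModuleCat.of A ((Fin k → A) ⧸ LinearMap.range D.vecMulLinear)) (d + 1) →
    ∀ w : Fin m → W, vm w D = 0 → ∃ u, w = vm u D'

theorem torVan_zero (W : Type) [AddCommGroup W] [Module Aᵐᵒᵖ W] : TorVan A 0 W := by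
  intro m k l D' D hD hp w hw
  have hp1 : Projective (ModuleCat.of A ((Fin k → A) ⧸ LinearMap.range D.vecMulLinear)) :=
    projective_iff_hasProjectiveDimensionLT_one.2 hp
  have hp2 : Module.Projective A ((Fin k → A) ⧸ LinearMap.range D.vecMulLinear) :=
    (IsProjective.iff_projective _).2 hp1
  obtain ⟨t, ht⟩ := Module.projective_lifting_property
    (LinearMap.range D.vecMulLinear).mkQ LinearMap.id (Submodule.mkQ_surjective _)
  let ρ : (Fin k → A) →ₗ[A] LinearMap.range D.vecMulLinear :=
    (LinearMap.id - t.comp (LinearMap.range D.vecMulLinear).mkQ).codRestrict _ (by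
      intro c
      refine (Submodule.Quotient.mk_eq_zero _).1 ?_
      change (LinearMap.range D.vecMulLinear).mkQ
        (c - t ((LinearMap.range D.vecMulLinear).mkQ c)) = 0
      have := LinearMap.congr_fun ht ((LinearMap.range D.vecMulLinear).mkQ c)
      simp only [LinearMap.comp_apply, LinearMap.id_apply] at this
      rw [map_sub, this, sub_self])
  obtain ⟨s, hs⟩ := Module.projective_lifting_property
    D.vecMulLinear.rangeRestrict ρ (LinearMap.surjective_rangeRestrict _)
  have key : ∀ v : Fin m → A, (v - s (v ᵥ* D)) ᵥ* D = 0 := by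
    intro v
    have h1 := congrArg Subtype.val (LinearMap.congr_fun hs (v ᵥ* D))
    have h2 : (LinearMap.range D.vecMulLinear).mkQ (v ᵥ* D) = 0 :=
      (Submodule.Quotient.mk_eq_zero _).2 ⟨v, rfl⟩
    have h3 : (s (v ᵥ* D)) ᵥ* D = v ᵥ* D := by
      refine h1.trans ?_
      change v ᵥ* D - t ((LinearMap.range D.vecMulLinear).mkQ (v ᵥ* D)) = _
      rw [h2, map_zero, sub_zero]
    rw [Matrix.sub_vecMul, h3, sub_self]
  choose U hU using fun v => hD.ex _ (key v)
  let S : Matrix (Fin k) (Fin m) A := LinearMap.toMatrixRight' s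
  have hS : ∀ c, s c = c ᵥ* S := by
    intro c
    conv_lhs => rw [← LinearMap.toMatrixRight'.symm_apply_apply s]
    rfl
  let U' : Matrix (Fin m) (Fin l) A := Matrix.of fun i => U (Pi.single i 1)
  have hmat : (1 : Matrix (Fin m) (Fin m) A) = U' * D' + D * S := by
    ext i j
    have := congrFun (hU (Pi.single i 1)) j
    rw [hS, Matrix.vecMul_vecMul, Matrix.single_one_vecMul] at this
    rw [Matrix.add_apply, Matrix.mul_apply, Matrix.one_apply]
    have h' : (U (Pi.single i 1) ᵥ* D') j = ∑ x, U' i x * D' x j := by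
      simp [Matrix.vecMul, dotProduct, U']
    rw [← h', ← this]
    simp [Pi.single_apply, eq_comm, Matrix.row]
  refine ⟨vm w U', ?_⟩
  rw [vm_vm]
  conv_lhs => rw [← vm_one (A := A) w, hmat, vm_add_right, ← vm_vm w D S, hw, vm_zero_left, add_zero]

theorem free_exact {m k l b : ℕ} {D' : Matrix (Fin l) (Fin m) A} {D : Matrix (Fin m) (Fin k) A}
    (hD : LEx D' D) (w : Fin m → (Fin b → Aᵐᵒᵖ)) (hw : vm w D = 0) : ∃ u, w = vm u D' := by
  have h : ∀ c : Fin b, ∃ u : Fin l → A, (fun i => unop (w i c)) = u ᵥ* D' := by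
    intro c
    apply hD.ex
    funext j
    have := congrArg unop (congrFun (congrFun hw j) c)
    simpa [vm, Matrix.vecMul, dotProduct] using this
  choose u hu using h
  refine ⟨fun i c => op (u c i), ?_⟩
  funext i c
  have := congrArg op (congrFun (hu c) i)
  simpa [vm, Matrix.vecMul, dotProduct] using this

theorem torVan_succ [IsNoetherianRing A] (d : ℕ) {W : Type} [AddCommGroup W] [Module Aᵐᵒᵖ W]
    (hW : TorVan A d W) {b : ℕ} (π : (Fin b → Aᵐᵒᵖ) →ₗ[Aᵐᵒᵖ] W) (hπ : Function.Surjective π) :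
    TorVan A (d + 1) (LinearMap.ker π) := by
  intro m k l D' D hD hp w hw
  obtain ⟨q, D'', hD''⟩ := exists_LEx D'
  have hp' : HasProjectiveDimensionLT
      (ModuleCat.of A ((Fin m → A) ⧸ LinearMap.range D'.vecMulLinear)) (d + 1) := by
    have hle : LinearMap.range D'.vecMulLinear ≤ LinearMap.ker D.vecMulLinear := by
      rintro _ ⟨u, rfl⟩
      simp [Matrix.vecMul_vecMul, hD.zero]
    let S : ShortComplex (ModuleCat.{0} A) :=
      ModuleCat.shortComplexOfCompEqZero
        ((LinearMap.range D'.vecMulLinear).liftQ D.vecMulLinear hle)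
        (LinearMap.range D.vecMulLinear).mkQ (by
          apply LinearMap.ext
          intro v
          obtain ⟨v, rfl⟩ := Submodule.mkQ_surjective _ v
          exact (Submodule.Quotient.mk_eq_zero _).2 ⟨v, rfl⟩)
    have hS : S.ShortExact := ModuleCat.shortComplex_shortExact S
      (by
        refine LinearMap.exact_iff.2 ?_
        exact (Submodule.ker_mkQ _).trans (Submodule.range_liftQ _ _ _).symm)
      (by
        refine LinearMap.ker_eq_bot.1 ?_
        refine Submodule.ker_liftQ_eq_bot _ _ _ ?_
        intro v hv
        obtain ⟨u, hu⟩ := hD.ex v hv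
        exact ⟨u, hu.symm⟩) (Submodule.mkQ_surjective _)
    exact (hS.hasProjectiveDimensionLT_X₃_iff d
      ((IsProjective.iff_projective _).1 (inferInstanceAs (Module.Projective A (Fin k → A))))).1 hp
  have hw1 : vm (fun i => (w i : Fin b → Aᵐᵒᵖ)) D = 0 := by
    have := vm_map (LinearMap.ker π).subtype w D
    rw [hw] at this
    exact this
  obtain ⟨g, hg⟩ := free_exact hD _ hw1
  have hg1 : vm (fun i => π (g i)) D' = 0 := by
    rw [vm_map, ← hg]
    funext j
    exact (w j).2
  obtain ⟨h, hh⟩ := hW _ _ _ _ _ hD'' hp' _ hg1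
  choose h' hh' using fun i => hπ (h i)
  refine ⟨fun i => ⟨(g - vm h' D'') i, ?_⟩, ?_⟩
  · rw [LinearMap.mem_ker, Pi.sub_apply, map_sub, sub_eq_zero]
    have h2 := congrFun (vm_map π h' D'') i
    rw [← h2]
    simp only [hh']
    exact congrFun hh i
  · have := vm_map (LinearMap.ker π).subtype (fun i => ⟨(g - vm h' D'') i, by
      rw [LinearMap.mem_ker, Pi.sub_apply, map_sub, sub_eq_zero]
      have h2 := congrFun (vm_map π h' D'') i
      rw [← h2]
      simp only [hh']
      exact congrFun hh i⟩) D'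
    funext i
    apply Subtype.ext
    have h3 := congrFun this i
    refine Eq.trans ?_ h3
    change _ = vm (g - vm h' D'') D' i
    rw [vm_sub_left, vm_vm, hD''.zero, vm_zero_right, sub_zero, ← hg]

theorem projective_of_torVan [IsNoetherianRing A] [IsNoetherianRing Aᵐᵒᵖ] (n : ℕ)
    (hgl : ∀ M : ModuleCat.{0} A, HasProjectiveDimensionLT M (n + 1))
    {K : Type} [AddCommGroup K] [Module Aᵐᵒᵖ K] [Module.Finite Aᵐᵒᵖ K] (hK : TorVan A n K) :
    Module.Projective Aᵐᵒᵖ K := by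
  obtain ⟨b, π, hπ⟩ := Module.Finite.exists_fin' Aᵐᵒᵖ K
  obtain ⟨a, r, hr⟩ := Submodule.fg_iff_exists_fin_generating_family.1
    (IsNoetherian.noetherian (LinearMap.ker π))
  let D : Matrix (Fin b) (Fin a) A := Matrix.of fun i j => unop (r j i)
  let κ : Fin b → K := fun i => π (Pi.single i 1)
  have hπκ : ∀ x, π x = ∑ i, x i • κ i := by
    intro x
    conv_lhs => rw [pi_eq_sum_univ' x]
    simp only [map_sum, map_smul, κ]
  have hκ : vm κ D = 0 := by
    funext j
    have : r j ∈ LinearMap.ker π := hr ▸ Submodule.subset_span ⟨j, rfl⟩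
    rw [LinearMap.mem_ker, hπκ] at this
    simpa [vm, D] using this
  obtain ⟨l, D', hD⟩ := exists_LEx D
  obtain ⟨u, hu⟩ := hK _ _ _ _ _ hD (hgl _) κ hκ
  choose c hc using fun i => hπ (u i)
  let C : Matrix (Fin b) (Fin l) A := Matrix.of fun i j => unop (c j i)
  have huC : u = vm κ C := by
    funext j
    rw [← hc, hπκ]
    simp [vm, C]
  rw [huC, vm_vm] at hu
  let G := C * D'
  have hGD : G * D = 0 := by rw [Matrix.mul_assoc, hD.zero, Matrix.mul_zero]
  let ψ : (Fin b → Aᵐᵒᵖ) →ₗ[Aᵐᵒᵖ] (Fin b → Aᵐᵒᵖ) :=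
    Fintype.linearCombination Aᵐᵒᵖ (fun i j => op (G j i))
  have hker : LinearMap.ker π ≤ LinearMap.ker ψ := by
    rw [← hr, Submodule.span_le]
    rintro _ ⟨j, rfl⟩
    rw [SetLike.mem_coe, LinearMap.mem_ker]
    funext i
    have := congrArg op (congrFun (congrFun hGD i) j)
    simpa [ψ, Fintype.linearCombination_apply, Matrix.mul_apply, D] using this
  have hψ : ∀ x, π (ψ x) = π x := by
    intro x
    rw [Fintype.linearCombination_apply, map_sum, hπκ x]
    refine Finset.sum_congr rfl fun i _ => ?_
    rw [map_smul, hπκ]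
    congr 1
    exact (congrFun hu i).symm
  let σ : K →ₗ[Aᵐᵒᵖ] (Fin b → Aᵐᵒᵖ) :=
    ((LinearMap.ker π).liftQ ψ hker).comp (π.quotKerEquivOfSurjective hπ).symm.toLinearMap
  refine Module.Projective.of_split σ π ?_
  ext x
  obtain ⟨x, rfl⟩ := hπ x
  have : (π.quotKerEquivOfSurjective hπ).symm (π x) = (LinearMap.ker π).mkQ x := by
    rw [LinearEquiv.symm_apply_eq]; rfl
  simp only [σ, LinearMap.comp_apply, LinearEquiv.coe_coe, this, LinearMap.id_apply]
  exact hψ x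

theorem projDim_op [IsNoetherianRing A] [IsNoetherianRing Aᵐᵒᵖ] (n : ℕ)
    (hgl : ∀ M : ModuleCat.{0} A, HasProjectiveDimensionLT M (n + 1)) (k : ℕ) :
    ∀ i, i + k = n → ∀ (W : ModuleCat.{0} Aᵐᵒᵖ), Module.Finite Aᵐᵒᵖ W → TorVan A i W →
      HasProjectiveDimensionLT W (k + 1) := by
  induction k with
  | zero =>
    rintro i rfl W hW ht
    rw [← projective_iff_hasProjectiveDimensionLT_one]
    exact (IsProjective.iff_projective _).1 (projective_of_torVan _ hgl ht)
  | succ k ih =>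
    intro i hi W hW ht
    obtain ⟨b, π, hπ⟩ := Module.Finite.exists_fin' Aᵐᵒᵖ W
    have h1 := ih (i + 1) (by omega) (ModuleCat.of _ (LinearMap.ker π))
      (inferInstanceAs (Module.Finite Aᵐᵒᵖ (LinearMap.ker π))) (torVan_succ i ht π hπ)
    let S : ShortComplex (ModuleCat.{0} Aᵐᵒᵖ) :=
      ModuleCat.shortComplexOfCompEqZero (LinearMap.ker π).subtype π (by ext x; simp)
    have hS : S.ShortExact := ModuleCat.shortComplex_shortExact S
      (by exact LinearMap.exact_subtype_ker_map π) Subtype.val_injective hπ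
    exact (hS.hasProjectiveDimensionLT_X₃_iff k
      ((IsProjective.iff_projective _).1
        (inferInstanceAs (Module.Projective Aᵐᵒᵖ (Fin b → Aᵐᵒᵖ))))).2 h1

end Part3

section Part4
variable {A E : Type} [Ring A] [Ring E]

/-- `φ` identifies `E` with a corner ring of `A`. -/
structure IsCornerMap (φ : E →ₙ+* A) : Prop where
  inj : Function.Injective φ
  surj : ∀ a, φ 1 * a = a → a * φ 1 = a → ∃ x, φ x = a

theorem phi_one_mul (φ : E →ₙ+* A) (x : E) : φ 1 * φ x = φ x := by rw [← map_mul, one_mul]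
theorem phi_mul_one (φ : E →ₙ+* A) (x : E) : φ x * φ 1 = φ x := by rw [← map_mul, mul_one]

/-- The subgroup `eN`. -/
def cSub (φ : E →ₙ+* A) (N : Type) [AddCommGroup N] [Module A N] : AddSubgroup N where
  carrier := {x | φ 1 • x = x}
  add_mem' := by intro a b ha hb; simp only [Set.mem_ofPred_eq] at *; rw [smul_add, ha, hb]
  zero_mem' := by simp
  neg_mem' := by intro a ha; simp only [Set.mem_ofPred_eq] at *; rw [smul_neg, ha]

instance cSub.instModule (φ : E →ₙ+* A) (N : Type) [AddCommGroup N] [Module A N] :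
    Module E (cSub φ N) where
  smul x a := ⟨φ x • a.1, show φ 1 • φ x • a.1 = φ x • a.1 by rw [← mul_smul, phi_one_mul]⟩
  one_smul a := Subtype.ext a.2
  mul_smul x y a := Subtype.ext (show φ (x * y) • a.1 = φ x • φ y • a.1 by rw [map_mul, mul_smul])
  smul_zero x := Subtype.ext (smul_zero _)
  smul_add x a b := Subtype.ext (smul_add _ _ _)
  add_smul x y a := Subtype.ext
    (show φ (x + y) • a.1 = φ x • a.1 + φ y • a.1 by rw [map_add, add_smul])
  zero_smul a := Subtype.ext (show φ 0 • a.1 = 0 by rw [map_zero, zero_smul])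

section
variable {N M : Type} [AddCommGroup N] [Module A N] [AddCommGroup M] [Module A M]

/-- functoriality of `eN`. -/
def cMap (φ : E →ₙ+* A) (f : N →ₗ[A] M) : cSub φ N →ₗ[E] cSub φ M where
  toFun x := ⟨f x.1, show φ 1 • f x.1 = f x.1 by rw [← map_smul]; exact congrArg f x.2⟩
  map_add' x y := Subtype.ext (map_add f _ _)
  map_smul' c x := Subtype.ext (map_smul f (φ c) x.1)

end

theorem ext_c_proj (φ : E →ₙ+* A) (Y : ModuleCat.{0} E)
    (N : Type) [AddCommGroup N] [Module A N] [Module.Finite A N] [Module.Projective A N]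
    (j : ℕ) (hY : Subsingleton (Abelian.Ext (ModuleCat.of E (cSub φ A)) Y j)) :
    Subsingleton (Abelian.Ext (ModuleCat.of E (cSub φ N)) Y j) := by
  obtain ⟨b, π, hπ⟩ := Module.Finite.exists_fin' A N
  obtain ⟨σ, hσ⟩ := Module.projective_lifting_property π LinearMap.id hπ
  refine ext_zero_of_sum (ι := Fin b)
    (fun i => ModuleCat.ofHom (cMap φ (LinearMap.proj i ∘ₗ σ)))
    (fun i => ModuleCat.ofHom (cMap φ (π ∘ₗ LinearMap.single A (fun _ => A) i))) ?_ j hY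
  have hsum : ∑ i, (cMap φ (π ∘ₗ LinearMap.single A (fun _ => A) i)) ∘ₗ
      (cMap φ (LinearMap.proj i ∘ₗ σ)) = LinearMap.id := by
    apply LinearMap.ext
    intro x
    apply Subtype.ext
    rw [LinearMap.sum_apply, AddSubgroup.val_finsetSum]
    change ∑ i, π (Pi.single i (σ x.1 i)) = x.1
    rw [← map_sum, Finset.univ_sum_single]
    exact LinearMap.congr_fun hσ x.1
  apply ModuleCat.hom_ext
  rw [ModuleCat.hom_sum]
  exact hsum

theorem ext_c (φ : E →ₙ+* A) [IsNoetherianRing A] (Y : ModuleCat.{0} E)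
    (hY : ∀ j, 0 < j → Subsingleton (Abelian.Ext (ModuleCat.of E (cSub φ A)) Y j)) (d : ℕ) :
    ∀ N : ModuleCat.{0} A, Module.Finite A N → HasProjectiveDimensionLT N (d + 1) →
      ∀ j, d < j → Subsingleton (Abelian.Ext (ModuleCat.of E (cSub φ N)) Y j) := by
  induction d with
  | zero =>
    intro N hN hp j hj
    have hp1 : Projective N := projective_iff_hasProjectiveDimensionLT_one.2 hp
    have hp2 : Module.Projective A N := (IsProjective.iff_projective _).2 hp1
    exact ext_c_proj φ Y N j (hY j hj)
  | succ d ih =>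
    intro N hN hp j hj
    obtain ⟨j, rfl⟩ : ∃ i, j = i + 1 := ⟨j - 1, by omega⟩
    obtain ⟨b, π, hπ⟩ := Module.Finite.exists_fin' A N
    have hK : HasProjectiveDimensionLT (ModuleCat.of A (LinearMap.ker π)) (d + 1) := by
      let S : ShortComplex (ModuleCat.{0} A) :=
        ModuleCat.shortComplexOfCompEqZero (LinearMap.ker π).subtype π (by ext x; simp)
      have hS : S.ShortExact := ModuleCat.shortComplex_shortExact S
        (by exact LinearMap.exact_subtype_ker_map π) Subtype.val_injective hπ
      exact (hS.hasProjectiveDimensionLT_X₃_iff d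
        ((IsProjective.iff_projective _).1
          (inferInstanceAs (Module.Projective A (Fin b → A))))).1 hp
    have h1 := ih (ModuleCat.of A (LinearMap.ker π))
      (inferInstanceAs (Module.Finite A (LinearMap.ker π))) hK j (by omega)
    let T : ShortComplex (ModuleCat.{0} E) :=
      ModuleCat.shortComplexOfCompEqZero (cMap φ (LinearMap.ker π).subtype) (cMap φ π) (by
        apply LinearMap.ext
        intro x
        exact Subtype.ext x.1.2)
    have hT : T.ShortExact := ModuleCat.shortComplex_shortExact T
      (by
        intro x
        constructor
        · intro hx
          have hx' : π x.1 = 0 := congrArg Subtype.val hx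
          exact ⟨⟨⟨x.1, hx'⟩, Subtype.ext x.2⟩, rfl⟩
        · rintro ⟨y, rfl⟩
          exact Subtype.ext y.1.2)
      (by
        intro x y hxy
        have h : x.1.1 = y.1.1 := congrArg (fun z : cSub φ (Fin b → A) => z.1) hxy
        exact Subtype.ext (Subtype.ext h))
      (by
        intro x
        obtain ⟨y, hy⟩ := hπ x.1
        refine ⟨⟨φ 1 • y, ?_⟩, ?_⟩
        · change φ 1 • φ 1 • y = φ 1 • y
          rw [← mul_smul, phi_one_mul]
        · apply Subtype.ext
          change π (φ 1 • y) = x.1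
          rw [map_smul, hy]
          exact x.2)
    have h2 : Subsingleton (Abelian.Ext T.X₂ Y (j + 1)) :=
      ext_c_proj φ Y (Fin b → A) (j + 1) (hY _ (by omega))
    have h1' : Subsingleton (Abelian.Ext T.X₁ Y j) := h1
    refine subsingleton_of_forall_eq 0 fun x => ?_
    obtain ⟨y, hy⟩ := Abelian.Ext.contravariant_sequence_exact₃ hT Y
      (n₁ := j + 1) x (Subsingleton.elim _ _) (n₀ := j) (by omega)
    rw [← hy, Subsingleton.elim y 0, Abelian.Ext.comp_zero]

/-- the left ideal of `A` attached to a left ideal of the corner. -/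
def cIdeal (φ : E →ₙ+* A) (I : Ideal E) : Ideal A := Ideal.span (φ '' I ∪ {1 - φ 1})

theorem mem_cIdeal {φ : E →ₙ+* A} (hφ : IsCornerMap φ) (I : Ideal E) (x : E) :
    φ x ∈ cIdeal φ I ↔ x ∈ I := by
  constructor
  · intro hx
    have key : ∀ y ∈ cIdeal φ I, ∀ a, ∃ i ∈ I, φ i = φ 1 * a * y * φ 1 := by
      intro y hy
      refine Submodule.span_induction (p := fun y _ => ∀ a, ∃ i ∈ I, φ i = φ 1 * a * y * φ 1)
        ?_ ?_ ?_ ?_ hy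
      · rintro y (⟨i, hi, rfl⟩ | hy) a
        · obtain ⟨z, hz⟩ := hφ.surj (φ 1 * a * φ 1)
            (by rw [← mul_assoc, ← mul_assoc, phi_one_mul])
            (by rw [mul_assoc, phi_one_mul])
          refine ⟨z * i, I.mul_mem_left _ hi, ?_⟩
          rw [map_mul, hz, mul_assoc _ (φ i), phi_mul_one, mul_assoc _ (φ 1), phi_one_mul]
        · refine ⟨0, I.zero_mem, ?_⟩
          rw [Set.mem_singleton_iff.1 hy, map_zero, mul_assoc _ _ (φ 1), sub_mul, one_mul,
            phi_one_mul, sub_self, mul_zero]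
      · intro a
        exact ⟨0, I.zero_mem, by simp⟩
      · intro y z _ _ h1 h2 a
        obtain ⟨i, hi, hi'⟩ := h1 a
        obtain ⟨k, hk, hk'⟩ := h2 a
        exact ⟨i + k, I.add_mem hi hk, by rw [map_add, hi', hk', mul_add, add_mul]⟩
      · intro c y _ h a
        obtain ⟨i, hi, hi'⟩ := h (a * c)
        exact ⟨i, hi, by rw [hi', smul_eq_mul]; simp only [mul_assoc]⟩
    obtain ⟨i, hi, hi'⟩ := key _ hx 1
    rw [mul_one, phi_one_mul, phi_mul_one] at hi'
    rwa [← hφ.inj hi']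
  · intro hx
    exact Ideal.subset_span (Or.inl ⟨x, hx, rfl⟩)

theorem cIdeal_mono (φ : E →ₙ+* A) : Monotone (cIdeal φ) := by
  intro I J h
  exact Ideal.span_mono (Set.union_subset_union_left _ (Set.image_mono h))

theorem noeth_corner {φ : E →ₙ+* A} (hφ : IsCornerMap φ) [IsNoetherianRing A] :
    IsNoetherianRing E := by
  have hinj : Function.Injective (cIdeal φ) := by
    intro I J h
    ext x
    rw [← mem_cIdeal hφ, h, mem_cIdeal hφ]
  have hsm : StrictMono (cIdeal φ) := (cIdeal_mono φ).strictMono_of_injective hinj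
  have hwf : WellFoundedGT (Ideal A) := inferInstance
  exact isNoetherian_iff'.2 hsm.wellFoundedGT

/-- `E/I ≅ e(A/J)` -/
theorem exists_cQuot {φ : E →ₙ+* A} (hφ : IsCornerMap φ) (I : Ideal E) :
    Nonempty ((E ⧸ I) ≃ₗ[E] cSub φ (A ⧸ cIdeal φ I)) := by
  let f : E →ₗ[E] cSub φ (A ⧸ cIdeal φ I) :=
    { toFun := fun x => ⟨(cIdeal φ I).mkQ (φ x), by
        change φ 1 • (cIdeal φ I).mkQ (φ x) = _
        rw [← map_smul, smul_eq_mul, phi_one_mul]⟩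
      map_add' := fun x y => Subtype.ext (by
        change (cIdeal φ I).mkQ (φ (x + y)) = (cIdeal φ I).mkQ (φ x) + (cIdeal φ I).mkQ (φ y)
        rw [map_add, map_add])
      map_smul' := fun c x => Subtype.ext (by
        change (cIdeal φ I).mkQ (φ (c * x)) = φ c • (cIdeal φ I).mkQ (φ x)
        rw [map_mul, ← map_smul, smul_eq_mul]) }
  have hker : LinearMap.ker f = I := by
    ext x
    rw [LinearMap.mem_ker, ← mem_cIdeal hφ, ← Submodule.Quotient.mk_eq_zero]
    exact Subtype.ext_iff
  have hsurj : Function.Surjective f := by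
    rintro ⟨y, hy⟩
    obtain ⟨a, rfl⟩ := Submodule.mkQ_surjective _ y
    obtain ⟨z, hz⟩ := hφ.surj (φ 1 * a * φ 1)
      (by rw [← mul_assoc, ← mul_assoc, phi_one_mul])
      (by rw [mul_assoc, phi_one_mul])
    refine ⟨z, Subtype.ext ?_⟩
    change (cIdeal φ I).mkQ (φ z) = (cIdeal φ I).mkQ a
    have hy' : (cIdeal φ I).mkQ (φ 1 * a) = (cIdeal φ I).mkQ a := hy
    rw [hz, ← hy', ← sub_eq_zero, ← map_sub]
    refine (Submodule.Quotient.mk_eq_zero _).2 ?_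
    have h1 : φ 1 * a * φ 1 - φ 1 * a = (-(φ 1 * a)) * (1 - φ 1) := by
      rw [mul_sub, neg_mul, neg_mul, mul_one]; abel
    rw [h1]
    exact Ideal.mul_mem_left _ _ (Ideal.subset_span (Or.inr rfl))
  exact ⟨(Submodule.quotEquivOfEq _ _ hker.symm).trans (f.quotKerEquivOfSurjective hsurj)⟩

theorem ext_of_equiv {R : Type} [Ring R] {X X' : Type} [AddCommGroup X] [Module R X]
    [AddCommGroup X'] [Module R X'] (f : X ≃ₗ[R] X') (Y : ModuleCat.{0} R) (j : ℕ)
    (h : Subsingleton (Abelian.Ext (ModuleCat.of R X') Y j)) :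
    Subsingleton (Abelian.Ext (ModuleCat.of R X) Y j) := by
  refine ext_zero_of_sum (ι := Unit) (fun _ => ModuleCat.ofHom f.toLinearMap)
    (fun _ => ModuleCat.ofHom f.symm.toLinearMap) ?_ j h
  rw [Fintype.sum_unique, ← ModuleCat.ofHom_comp]
  simp

end Part4

section Part5
variable {A E : Type} [Ring A] [Ring E]

theorem corner_main {φ : E →ₙ+* A} (hφ : IsCornerMap φ) [IsNoetherianRing A]
    (Y : ModuleCat.{0} E)
    (hY : ∀ j, 0 < j → Subsingleton (Abelian.Ext (ModuleCat.of E (cSub φ A)) Y j)) (n : ℕ)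
    (hpd : ∀ N : ModuleCat.{0} A, Module.Finite A N → HasProjectiveDimensionLT N (n + 1)) :
    hasInjDimLE E Y n := by
  refine exists_injRes n Y (injDim_of_baer n Y fun I => ?_)
  obtain ⟨f⟩ := exists_cQuot hφ I
  refine ext_of_equiv f Y _ ?_
  exact ext_c φ Y hY n (ModuleCat.of A (A ⧸ cIdeal φ I))
    (inferInstanceAs (Module.Finite A (A ⧸ cIdeal φ I))) (hpd _
      (inferInstanceAs (Module.Finite A (A ⧸ cIdeal φ I)))) (n + 1) (Nat.lt_succ_self n)

/-- inclusion of the corner -/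
def cornerIncl {e : A} (he : IsIdempotentElem e) : Corner e he →ₙ+* A where
  toFun x := x.1
  map_mul' _ _ := rfl
  map_zero' := rfl
  map_add' _ _ := rfl

/-- inclusion of the opposite corner -/
def cornerInclOp {e : A} (he : IsIdempotentElem e) : (Corner e he)ᵐᵒᵖ →ₙ+* Aᵐᵒᵖ where
  toFun x := MulOpposite.op x.unop.1
  map_mul' _ _ := rfl
  map_zero' := rfl
  map_add' _ _ := rfl

theorem cornerIncl_isCornerMap {e : A} (he : IsIdempotentElem e) :
    IsCornerMap (cornerIncl he) where
  inj _ _ h := Subtype.ext h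
  surj a h1 h2 := ⟨⟨a, h1, h2⟩, rfl⟩

theorem cornerInclOp_isCornerMap {e : A} (he : IsIdempotentElem e) :
    IsCornerMap (cornerInclOp he) where
  inj _ _ h := MulOpposite.unop_injective (Subtype.ext (MulOpposite.op_injective h))
  surj a h1 h2 := ⟨MulOpposite.op ⟨a.unop, congrArg MulOpposite.unop h2,
    congrArg MulOpposite.unop h1⟩, rfl⟩

/-- comparison of the two models of `eA` -/
def eAEquiv {e : A} (he : IsIdempotentElem e) :
    cSub (cornerIncl he) A ≃ₗ[Corner e he] eASubgroup A e where
  toFun x := ⟨x.1, x.2⟩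
  invFun x := ⟨x.1, x.2⟩
  map_add' _ _ := rfl
  map_smul' _ _ := rfl
  left_inv _ := rfl
  right_inv _ := rfl

/-- comparison of the two models of `Ae` -/
def AeEquiv {e : A} (he : IsIdempotentElem e) :
    cSub (cornerInclOp he) Aᵐᵒᵖ ≃ₗ[(Corner e he)ᵐᵒᵖ] AeSubgroup A e where
  toFun x := ⟨x.1.unop, congrArg MulOpposite.unop x.2⟩
  invFun x := ⟨MulOpposite.op x.1, congrArg MulOpposite.op x.2⟩
  map_add' _ _ := rfl
  map_smul' _ _ := rfl
  left_inv _ := rfl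
  right_inv _ := rfl

end Part5


section Part6
universe u

theorem projDim_of_hasProjDimLE_univ {A : Type} [Ring A] (M : ModuleCat.{u} A) (n : ℕ)
    (h : hasProjDimLE A M n) : HasProjectiveDimensionLT M (n + 1) := by
  obtain ⟨P, hP⟩ := h
  rw [hasProjectiveDimensionLT_iff]
  intro i hi Y a
  obtain ⟨f, hf, rfl⟩ := P.extMk_surjective a (i+1) rfl
  obtain rfl : f = 0 := (hP i (by omega)).eq_of_src _ _
  simp

theorem projDim_of_ulift {A : Type} [Ring A] (d : ℕ) :
    ∀ M : ModuleCat.{0} A,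
      HasProjectiveDimensionLT (ModuleCat.of.{u} A (ULift.{u} M)) (d + 1) →
      HasProjectiveDimensionLT M (d + 1) := by
  induction d with
  | zero =>
    intro M h
    rw [← projective_iff_hasProjectiveDimensionLT_one] at h ⊢
    have h2 : Module.Projective A (ULift.{u} M) := (IsProjective.iff_projective _).2 h
    exact (IsProjective.iff_projective _).1 (Module.Projective.of_equiv ULift.moduleEquiv)
  | succ d ih =>
    intro M h
    obtain ⟨F, _, _, hF, π, hπ⟩ : ∃ (F : Type) (_ : AddCommGroup F) (_ : Module A F),
        Module.Projective A F ∧ ∃ π : F →ₗ[A] M, Function.Surjective π :=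
      ⟨M →₀ A, inferInstance, inferInstance, inferInstance,
        Finsupp.linearCombination A (id : M → M), Finsupp.linearCombination_id_surjective A M⟩
    let S : ShortComplex (ModuleCat.{0} A) :=
      ModuleCat.shortComplexOfCompEqZero (LinearMap.ker π).subtype π (by ext x; simp)
    have hS : S.ShortExact := ModuleCat.shortComplex_shortExact S
      (by exact LinearMap.exact_subtype_ker_map π) Subtype.val_injective hπ
    refine (hS.hasProjectiveDimensionLT_X₃_iff d
      ((IsProjective.iff_projective _).1 hF)).2 (ih _ ?_)
    let f : ULift.{u} (LinearMap.ker π) →ₗ[A] ULift.{u} F :=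
      ULift.moduleEquiv.symm.toLinearMap ∘ₗ (LinearMap.ker π).subtype ∘ₗ
        ULift.moduleEquiv.toLinearMap
    let g : ULift.{u} F →ₗ[A] ULift.{u} M :=
      ULift.moduleEquiv.symm.toLinearMap ∘ₗ π ∘ₗ ULift.moduleEquiv.toLinearMap
    let T : ShortComplex (ModuleCat.{u} A) :=
      ModuleCat.shortComplexOfCompEqZero f g (by
        apply LinearMap.ext
        intro x
        exact ULift.ext _ _ x.down.2)
    have hT : T.ShortExact := ModuleCat.shortComplex_shortExact T
      (by
        intro x
        constructor
        · intro hx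
          have hx' : π x.down = 0 := congrArg (fun z : ULift.{u} M => z.down) hx
          exact ⟨⟨⟨x.down, hx'⟩⟩, rfl⟩
        · rintro ⟨y, rfl⟩
          exact ULift.ext _ _ y.down.2)
      (by
        intro x y hxy
        have h : x.down.1 = y.down.1 := congrArg (fun z : ULift.{u} F => z.down) hxy
        exact ULift.ext _ _ (Subtype.ext h))
      (by
        intro x
        obtain ⟨y, hy⟩ := hπ x.down
        exact ⟨⟨y⟩, ULift.ext _ _ hy⟩)
    have hproj : Module.Projective A (ULift.{u} F) :=
      Module.Projective.of_equiv ULift.moduleEquiv.symm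
    exact (hT.hasProjectiveDimensionLT_X₃_iff d
      ((IsProjective.iff_projective _).1 hproj)).1 h

end Part6

/-- Let `A` be a noetherian ring of global dimension at most `n`, let
`e ∈ A` be an idempotent and `E = eAe`.  If `Ext^i_E(eA, E) = 0` for all `i > 0` and
`Ext^i_{Eᵒᵖ}(Ae, E) = 0` for all `i > 0`, then `E` is a noetherian ring with
`inj.dim _E E ≤ n` and `inj.dim E_E ≤ n`, i.e. `E` is Iwanaga–Gorenstein of dimension at
most `n`. -/
theorem corner_ring_iwanaga_gorenstein
    (n : ℕ) (A : Type) [Ring A] [IsNoetherianRing A] [IsNoetherianRing Aᵐᵒᵖ]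
    (hgl : ∀ M : ModuleCat A, hasProjDimLE A M n)
    (e : A) (he : IsIdempotentElem e)
    (hExt : ∀ i : ℕ, 0 < i →
      Subsingleton (extGroup (Corner e he) i
        (ModuleCat.of (Corner e he) (eASubgroup A e))
        (ModuleCat.of (Corner e he) (Corner e he))))
    (hExtOp : ∀ i : ℕ, 0 < i →
      Subsingleton (extGroup (Corner e he)ᵐᵒᵖ i
        (ModuleCat.of (Corner e he)ᵐᵒᵖ (AeSubgroup A e))
        (ModuleCat.of (Corner e he)ᵐᵒᵖ (Corner e he)))) :
    IsNoetherianRing (Corner e he) ∧ IsNoetherianRing (Corner e he)ᵐᵒᵖ ∧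
    hasInjDimLE (Corner e he) (ModuleCat.of (Corner e he) (Corner e he)) n ∧
    hasInjDimLE (Corner e he)ᵐᵒᵖ (ModuleCat.of (Corner e he)ᵐᵒᵖ (Corner e he)) n := by
  have hpd : ∀ M : ModuleCat.{0} A, HasProjectiveDimensionLT M (n + 1) :=
    fun M => projDim_of_ulift n M (projDim_of_hasProjDimLE_univ _ n (hgl _))
  refine ⟨noeth_corner (cornerIncl_isCornerMap he), noeth_corner (cornerInclOp_isCornerMap he),
    ?_, ?_⟩
  · exact corner_main (cornerIncl_isCornerMap he) _ (fun j hj => ext_of_equiv (eAEquiv he) _ j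
      (ext_subsingleton_of_extGroup j hj _ _ (hExt j hj))) n (fun N _ => hpd N)
  · exact corner_main (cornerInclOp_isCornerMap he) _ (fun j hj => ext_of_equiv (AeEquiv he) _ j
      (ext_subsingleton_of_extGroup j hj _ _ (hExtOp j hj))) n
      (fun N hN => projDim_op n hpd n 0 (Nat.zero_add n) N hN (torVan_zero N))
end

section
/- Let (S, 𝔪) be a commutative noetherian local Gorenstein ring of Krull dimension d (i.e. S has finite injective dimension as an S-module, which then equals d), and let Γ be an S-algebra that is finitely generated as an S-module and is maximal Cohen–Macaulay as an S-module (depth_S Γ = d). Then the left Γ-module Hom_S(Γ, S) has injective dimension exactly d, and likewise Hom_S(Γ, S) has injective dimension exactly d as a right Γ-module. -/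
section HomDual

variable (S : Type) [CommRing S] (Γ : Type) [Ring Γ] [Algebra S Γ]

/-- Right multiplication by `γ` on `Γ`, as an `S`-linear map. -/
def rmulS (γ : Γ) : Γ →ₗ[S] Γ where
  toFun x := x * γ
  map_add' a b := add_mul a b γ
  map_smul' s x := smul_mul_assoc s x γ

/-- The left `Γ`-module structure on `Hom_S(Γ, S)`, given by `(γ • f) x = f (x * γ)`. -/
instance instModHomLeft : Module Γ (Γ →ₗ[S] S) where
  smul γ f := f.comp (rmulS S Γ γ)
  one_smul f := LinearMap.ext fun x => show f (x * 1) = f x by rw [mul_one]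
  mul_smul γ δ f := LinearMap.ext fun x =>
    show f (x * (γ * δ)) = f ((x * γ) * δ) by rw [mul_assoc]
  smul_zero γ := LinearMap.ext fun x => rfl
  smul_add γ f g := LinearMap.ext fun x => rfl
  add_smul γ δ f := LinearMap.ext fun x =>
    show f (x * (γ + δ)) = f (x * γ) + f (x * δ) by rw [mul_add, map_add]
  zero_smul f := LinearMap.ext fun x => show f (x * 0) = 0 by rw [mul_zero, map_zero]

variable (X : Type) [AddCommGroup X] [Module S X] [Module Γ X] [IsScalarTower S Γ X]

/-- Scalar multiplication by `γ` on a left `Γ`-module, as an `S`-linear map. -/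
def lsmulS (γ : Γ) : X →ₗ[S] X where
  toFun x := γ • x
  map_add' := smul_add γ
  map_smul' s x := show γ • (s • x) = s • (γ • x) by
    rw [← algebraMap_smul Γ s x, ← mul_smul, ← Algebra.commutes s γ, mul_smul,
      algebraMap_smul]

/-- The right `Γ`-module structure on `Hom_S(X, S)` for a left `Γ`-module `X`, given by
`(f · γ) x = f (γ • x)`. -/
instance instModHomRight : Module Γᵐᵒᵖ (X →ₗ[S] S) where
  smul γ f := f.comp (lsmulS S Γ X γ.unop)
  one_smul f := LinearMap.ext fun x => show f ((1 : Γ) • x) = f x by rw [one_smul]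
  mul_smul γ δ f := LinearMap.ext fun x =>
    show f ((δ.unop * γ.unop) • x) = f (δ.unop • γ.unop • x) by rw [mul_smul]
  smul_zero γ := LinearMap.ext fun x => rfl
  smul_add γ f g := LinearMap.ext fun x => rfl
  add_smul γ δ f := LinearMap.ext fun x =>
    show f ((γ.unop + δ.unop) • x) = f (γ.unop • x) + f (δ.unop • x) by
      rw [add_smul, map_add]
  zero_smul f := LinearMap.ext fun x => show f ((0 : Γ) • x) = 0 by
    rw [zero_smul, map_zero]

end HomDual

open CategoryTheory

/-- The depth of a module `X` over a commutative noetherian local ring `S`: the least `i`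
such that `Ext^i_S(S/𝔪, X) ≠ 0` (as an element of `ℕ∞`, with `⊤` if there is no such `i`). -/
noncomputable def moduleDepth (S : Type) [CommRing S] [IsLocalRing S] (X : ModuleCat S) : ℕ∞ :=
  sInf {i : ℕ∞ | ∃ n : ℕ, i = (n : ℕ∞) ∧
    Nontrivial (extGroup S n (ModuleCat.of S (S ⧸ IsLocalRing.maximalIdeal S)) X)}

/-- The injective dimension of a left `A`-module, as an element of `ℕ∞`. -/
noncomputable def injDim (A : Type) [Ring A] (M : ModuleCat A) : ℕ∞ :=
  sInf {n : ℕ∞ | ∃ m : ℕ, n = (m : ℕ∞) ∧ hasInjDimLE A M m}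

/-- The projective dimension of a left `A`-module, as an element of `ℕ∞`. -/
noncomputable def projDim (A : Type) [Ring A] (M : ModuleCat A) : ℕ∞ :=
  sInf {n : ℕ∞ | ∃ m : ℕ, n = (m : ℕ∞) ∧ hasProjDimLE A M m}

namespace HD
open Abelian

section LES
variable {C : Type 1} [Category.{0} C] [Abelian C] [HasExt.{0} C]

lemma con2 {T : ShortComplex C} (h : T.ShortExact) (Y : C) (i : ℕ)
    (h1 : Subsingleton (Abelian.Ext T.X₁ Y i)) (h3 : Subsingleton (Abelian.Ext T.X₃ Y i)) :
    Subsingleton (Abelian.Ext T.X₂ Y i) := by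
  refine subsingleton_of_forall_eq 0 fun x => ?_
  obtain ⟨y, rfl⟩ := Abelian.Ext.contravariant_sequence_exact₂ h Y x (Subsingleton.elim _ _)
  rw [Subsingleton.elim y 0]; simp

lemma con1 {T : ShortComplex C} (h : T.ShortExact) (Y : C) (i : ℕ)
    (h1 : Subsingleton (Abelian.Ext T.X₂ Y i)) (h3 : Subsingleton (Abelian.Ext T.X₃ Y (i+1))) :
    Subsingleton (Abelian.Ext T.X₁ Y i) := by
  refine subsingleton_of_forall_eq 0 fun x => ?_
  obtain ⟨y, rfl⟩ := Abelian.Ext.contravariant_sequence_exact₁ h Y x (add_comm 1 i)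
    (Subsingleton.elim _ _)
  rw [Subsingleton.elim y 0]; simp

lemma con3 {T : ShortComplex C} (h : T.ShortExact) (Y : C) (i : ℕ)
    (h1 : Subsingleton (Abelian.Ext T.X₁ Y i)) (h3 : Subsingleton (Abelian.Ext T.X₂ Y (i+1))) :
    Subsingleton (Abelian.Ext T.X₃ Y (i+1)) := by
  refine subsingleton_of_forall_eq 0 fun x => ?_
  obtain ⟨y, rfl⟩ := Abelian.Ext.contravariant_sequence_exact₃ h Y x
    (Subsingleton.elim _ _) (add_comm 1 i)
  rw [Subsingleton.elim y 0]; simp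

lemma con3z {T : ShortComplex C} (h : T.ShortExact) (Y : C)
    (h3 : Subsingleton (Abelian.Ext T.X₂ Y 0)) :
    Subsingleton (Abelian.Ext T.X₃ Y 0) := by
  have := h.epi_g
  exact (Abelian.Ext.precomp_mk₀_injective_of_epi Y T.g).subsingleton

lemma cov1 {T : ShortComplex C} (h : T.ShortExact) (X : C) (i : ℕ)
    (h1 : Subsingleton (Abelian.Ext X T.X₃ i)) (h3 : Subsingleton (Abelian.Ext X T.X₂ (i+1))) :
    Subsingleton (Abelian.Ext X T.X₁ (i+1)) := by
  refine subsingleton_of_forall_eq 0 fun x => ?_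
  obtain ⟨y, rfl⟩ := Abelian.Ext.covariant_sequence_exact₁ X h x
    (Subsingleton.elim _ _) rfl
  rw [Subsingleton.elim y 0]; simp

lemma cov3 {T : ShortComplex C} (h : T.ShortExact) (X : C) (i : ℕ)
    (h1 : Subsingleton (Abelian.Ext X T.X₂ i)) (h3 : Subsingleton (Abelian.Ext X T.X₁ (i+1))) :
    Subsingleton (Abelian.Ext X T.X₃ i) := by
  refine subsingleton_of_forall_eq 0 fun x => ?_
  obtain ⟨y, rfl⟩ := Abelian.Ext.covariant_sequence_exact₃ X h x rfl
    (Subsingleton.elim _ _)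
  rw [Subsingleton.elim y 0]; simp

lemma ext_congr_left {X X' : C} (e : X ≅ X') (Y : C) (i : ℕ)
    (h : Subsingleton (Abelian.Ext X Y i)) : Subsingleton (Abelian.Ext X' Y i) := by
  refine subsingleton_of_forall_eq 0 fun x => ?_
  have : (Abelian.Ext.mk₀ e.inv).comp ((Abelian.Ext.mk₀ e.hom).comp x (zero_add i)) (zero_add i) = x := by
    simp
  rw [← this, Subsingleton.elim ((Abelian.Ext.mk₀ e.hom).comp x (zero_add i)) 0]; simp

lemma ext_congr_right {Y Y' : C} (e : Y ≅ Y') (X : C) (i : ℕ)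
    (h : Subsingleton (Abelian.Ext X Y i)) : Subsingleton (Abelian.Ext X Y' i) := by
  refine subsingleton_of_forall_eq 0 fun x => ?_
  have : (x.comp (Abelian.Ext.mk₀ e.inv) (add_zero i)).comp (Abelian.Ext.mk₀ e.hom) (add_zero i) = x := by
    simp
  rw [← this, Subsingleton.elim (x.comp (Abelian.Ext.mk₀ e.inv) (add_zero i)) 0]; simp

end LES

section Comm
variable {R : Type} [CommRing R] [IsNoetherianRing R] [IsLocalRing R]
open IsLocalRing

/-- Nakayama step. -/
lemma nak (M N : ModuleCat.{0} R) [Module.Finite R M] [Module.Finite R N] (x : R)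
    (hx : x ∈ maximalIdeal R) (hr : IsSMulRegular N x) (i : ℕ)
    (h : Subsingleton (Abelian.Ext (ModuleCat.of R (QuotSMulTop x N)) M (i+1))) :
    Subsingleton (Abelian.Ext N M i) := by
  have hs := hr.smulShortComplex_shortExact
  have key : ∀ e : Abelian.Ext N M i, ∃ e' : Abelian.Ext N M i, x • e' = e := by
    intro e
    obtain ⟨y, hy⟩ := Abelian.Ext.contravariant_sequence_exact₁ hs M (n₀ := i) e (add_comm 1 i)
      (h.elim _ _)
    have aux : ∀ y : Abelian.Ext N M i,
        (Abelian.Ext.mk₀ (x • 𝟙 N)).comp y (zero_add i) = x • y := by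
      intro y
      rw [Abelian.Ext.mk₀_smul, Abelian.Ext.smul_comp]
      simp
    exact ⟨y, (aux y).symm.trans hy⟩
  have : (⊤ : Submodule R (Abelian.Ext N M i)) = ⊥ := by
    apply Submodule.eq_bot_of_le_smul_of_le_jacobson_bot (maximalIdeal R) ⊤ Module.Finite.fg_top
    · intro e _
      obtain ⟨e', rfl⟩ := key e
      exact Submodule.smul_mem_smul hx trivial
    · exact (IsLocalRing.jacobson_eq_maximalIdeal ⊥ bot_ne_top).ge
  exact (Submodule.subsingleton_iff R).mp (subsingleton_of_bot_eq_top this.symm)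

end Comm
end HD

namespace HD
set_option linter.unusedSectionVars false
open Abelian
section Comm
variable {R : Type} [CommRing R] [IsNoetherianRing R] [IsLocalRing R]
open IsLocalRing

variable (R) in
/-- The residue field as a module. -/
abbrev kk : ModuleCat.{0} R := ModuleCat.of R (R ⧸ maximalIdeal R)

lemma bump (M : ModuleCat.{0} R) [Module.Finite R M] (n : ℕ)
    (h1 : ∀ N : ModuleCat.{0} R, Module.Finite R N → Subsingleton (Abelian.Ext N M (n+1)))
    (hk : Subsingleton (Abelian.Ext (kk R) M n))
    (N : ModuleCat.{0} R) (hN : Module.Finite R N) : Subsingleton (Abelian.Ext N M n) := by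
  suffices H : ∀ (N : Type) [AddCommGroup N] [Module R N] (_ : Module.Finite R N),
      Subsingleton (Abelian.Ext (ModuleCat.of R N) M n) from H N hN
  intro N _ _ hN
  induction hN using IsNoetherianRing.induction_on_isQuotientEquivQuotientPrime R with
  | subsingleton N =>
    refine subsingleton_of_forall_eq 0 fun x => ?_
    have hz : Limits.IsZero (ModuleCat.of R N) := ModuleCat.isZero_of_subsingleton _
    rw [← Abelian.Ext.mk₀_id_comp x, hz.eq_of_src (𝟙 _) 0]
    simp
  | quotient N p e =>
    refine ext_congr_left e.symm.toModuleIso M n ?_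
    by_cases hp : p.1 = maximalIdeal R
    · rw [hp]; exact hk
    · obtain ⟨x, hx, hxp⟩ : ∃ x ∈ maximalIdeal R, x ∉ p.1 := by
        by_contra! hcon
        exact hp (le_antisymm (le_maximalIdeal p.2.ne_top) hcon)
      refine nak M (ModuleCat.of R (R ⧸ p.1)) x hx ?_ n (h1 _ inferInstance)
      rw [isSMulRegular_iff_right_eq_zero_of_smul]
      intro y hy
      obtain ⟨y, rfl⟩ := Ideal.Quotient.mk_surjective y
      have : Ideal.Quotient.mk p.1 (x * y) = 0 := by
        rw [map_mul]; exact hy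
      rw [Ideal.Quotient.eq_zero_iff_mem] at this ⊢
      exact (p.2.mem_or_mem this).resolve_left hxp
  | exact N₁ N₂ N₃ f g hf hg hfg h₁ h₃ =>
    let T := ModuleCat.shortComplexOfCompEqZero f g hfg.linearMap_comp_eq_zero
    have hT : T.ShortExact := ModuleCat.shortComplex_shortExact T hfg hf hg
    exact con2 hT M n h₁ h₃

/-- finite injective dimension tested on finite modules -/
def FID (M : ModuleCat.{0} R) (n : ℕ) : Prop :=
  ∀ i, n < i → ∀ N : ModuleCat.{0} R, Module.Finite R N → Subsingleton (Abelian.Ext N M i)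

lemma FID.descend {M : ModuleCat.{0} R} [Module.Finite R M] {n : ℕ} (h : FID M n) (t : ℕ)
    (hk : ∀ i, t < i → (∀ N : ModuleCat.{0} R, Module.Finite R N →
      Subsingleton (Abelian.Ext N M (i+1))) → Subsingleton (Abelian.Ext (kk R) M i)) : FID M t := by
  have : ∀ m, FID M (t + m) → FID M t := by
    intro m
    induction m with
    | zero => exact id
    | succ m ih =>
      intro H
      apply ih
      intro i hi
      obtain hi | rfl := (Nat.succ_le_of_lt hi).lt_or_eq
      · exact H i (by omega)
      · have h1 := H (t + m + 1 + 1) (by omega)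
        exact bump M (t+m+1) h1 (hk _ (by omega) h1)
  exact this n fun i hi => h i (by omega)

lemma kk_smul {x : R} (hx : x ∈ maximalIdeal R) : x ∈ Module.annihilator R (kk R) := by
  simpa [Ideal.annihilator_quotient] using hx

lemma kk_ann {x : R} (hx : x ∈ Module.annihilator R (kk R)) : x ∈ maximalIdeal R := by
  simpa [Ideal.annihilator_quotient] using hx

/-- a nonzero map from the residue field is injective, giving a short exact sequence -/
lemma kk_embed (N : ModuleCat.{0} R) [Module.Finite R N] (f : (R ⧸ maximalIdeal R) →ₗ[R] N)
    (hf : f ≠ 0) (M : ModuleCat.{0} R) (i : ℕ)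
    (h1 : Subsingleton (Abelian.Ext N M i))
    (h2 : ∀ N : ModuleCat.{0} R, Module.Finite R N → Subsingleton (Abelian.Ext N M (i+1))) :
    Subsingleton (Abelian.Ext (kk R) M i) := by
  have hinj : Function.Injective f := by
    have : IsSimpleModule R (R ⧸ maximalIdeal R) := by
      rw [isSimpleModule_iff_isCoatom]
      exact (maximalIdeal.isMaximal R).out
    exact (LinearMap.injective_or_eq_zero f).resolve_right hf
  let T := ModuleCat.shortComplexOfCompEqZero f f.range.mkQ f.exact_map_mkQ_range.linearMap_comp_eq_zero
  have hT : T.ShortExact := ModuleCat.shortComplex_shortExact T f.exact_map_mkQ_range hinj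
    (Submodule.mkQ_surjective _)
  exact con1 hT M i h1 (h2 (ModuleCat.of R (N ⧸ f.range)) inferInstance)

lemma exists_reg (N : ModuleCat.{0} R) [Module.Finite R N]
    (h : Subsingleton (Abelian.Ext (kk R) N 0)) :
    ∃ x ∈ maximalIdeal R, IsSMulRegular N x := by
  have : Subsingleton (kk R ⟶ N) := Abelian.Ext.addEquiv₀.subsingleton_congr.mp h
  have : Subsingleton (kk R →ₗ[R] N) := ModuleCat.homAddEquiv.symm.subsingleton
  obtain ⟨x, mem_ann, hx⟩ := IsSMulRegular.subsingleton_linearMap_iff.mp this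
  exact ⟨x, kk_ann mem_ann, hx⟩

lemma depth_quot (N : ModuleCat.{0} R) (x : R) (hx : x ∈ maximalIdeal R)
    (hr : IsSMulRegular N x) (r : ℕ)
    (h : Subsingleton (Abelian.Ext (kk R) (ModuleCat.of R (QuotSMulTop x N)) r)) :
    Subsingleton (Abelian.Ext (kk R) N (r+1)) := by
  have hs := hr.smulShortComplex_shortExact
  refine subsingleton_of_forall_eq 0 fun e => ?_
  obtain ⟨y, hy⟩ := Abelian.Ext.covariant_sequence_exact₁ (kk R) hs (n₁ := r+1) e
    (congr($(Abelian.Ext.postcomp_smul_id_eq_zero_of_mem_annihilator (N := kk R) (M := N)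
      (kk_smul hx) (r+1)) e)) rfl
  have h' : Subsingleton (Abelian.Ext (kk R) (N.smulShortComplex x).X₃ r) := h
  rw [Subsingleton.elim y 0, Abelian.Ext.zero_comp] at hy
  exact hy.symm

lemma fid_of_depth {M : ModuleCat.{0} R} [Module.Finite R M] {n : ℕ} (h : FID M n) (r : ℕ) :
    ∀ (N : ModuleCat.{0} R) [Module.Finite R N] (j : ℕ),
    (∀ i, i < r → Subsingleton (Abelian.Ext (kk R) N i)) →
    ¬ Subsingleton (Abelian.Ext (kk R) N r) →
    (∀ i, j < i → Subsingleton (Abelian.Ext N M i)) → FID M (j + r) := by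
  induction r with
  | zero =>
    intro N _ j _ h2 h3
    have : ¬ Subsingleton (kk R →ₗ[R] N) := fun H => h2
      ((Abelian.Ext.addEquiv₀.trans ModuleCat.homAddEquiv).subsingleton)
    obtain ⟨f, hf⟩ : ∃ f : kk R →ₗ[R] N, f ≠ 0 := by
      by_contra! hcon
      exact this (subsingleton_of_forall_eq 0 hcon)
    exact h.descend j fun i hi h' => kk_embed N f hf M i (h3 i hi) h'
  | succ r ih =>
    intro N _ j h1 h2 h3
    obtain ⟨x, hx, hr⟩ := exists_reg N (h1 0 (by omega))
    have := ih (ModuleCat.of R (QuotSMulTop x N)) (j+1) ?_ ?_ ?_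
    · rwa [show j + (r + 1) = j + 1 + r by ring]
    · intro i hi
      exact cov3 hr.smulShortComplex_shortExact _ i (h1 i (by omega)) (h1 (i+1) (by omega))
    · exact fun H => h2 (depth_quot N x hx hr r H)
    · intro i hi
      obtain ⟨i, rfl⟩ : ∃ i', i = i' + 1 := ⟨i - 1, by omega⟩
      exact con3 hr.smulShortComplex_shortExact M i (h3 i (by omega)) (h3 (i+1) (by omega))

lemma ischebeck {M : ModuleCat.{0} R} [Module.Finite R M] {t : ℕ} (h : FID M t) (r : ℕ) :
    ∀ (N : ModuleCat.{0} R) [Module.Finite R N],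
    (∀ i, i < r → Subsingleton (Abelian.Ext (kk R) N i)) →
    ∀ i, t < i + r → Subsingleton (Abelian.Ext N M i) := by
  induction r with
  | zero => exact fun N _ _ i hi => h i hi N inferInstance
  | succ r ih =>
    intro N _ h1 i hi
    obtain ⟨x, hx, hr⟩ := exists_reg N (h1 0 (by omega))
    refine nak M N x hx hr i (ih (ModuleCat.of R (QuotSMulTop x N)) ?_ (i+1) (by omega))
    intro i hi
    exact cov3 hr.smulShortComplex_shortExact _ i (h1 i (by omega)) (h1 (i+1) (by omega))

end Comm
end HD

namespace HD
set_option linter.unusedSectionVars false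
open Abelian
section Comm
variable {R : Type} [CommRing R] [IsNoetherianRing R] [IsLocalRing R]
open IsLocalRing RingTheory.Sequence

lemma smul_lt (M : ModuleCat.{0} R) [Module.Finite R M] [Nontrivial M] :
    maximalIdeal R • (⊤ : Submodule R M) < ⊤ := by
  apply lt_top_iff_ne_top.mpr
  intro h
  apply (top_ne_bot : (⊤ : Submodule R M) ≠ ⊥)
  exact Submodule.eq_bot_of_le_smul_of_le_jacobson_bot (maximalIdeal R) ⊤ Module.Finite.fg_top h.ge
    (IsLocalRing.jacobson_eq_maximalIdeal ⊥ bot_ne_top).ge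

lemma supp_kk : Module.support R (kk R) = PrimeSpectrum.zeroLocus (maximalIdeal R) := by
  rw [Module.support_eq_zeroLocus, Ideal.annihilator_quotient]

lemma rees_kk (M : ModuleCat.{0} R) [Module.Finite R M] [Nontrivial M] (n : ℕ)
    (h : ∀ i < n, Subsingleton (Abelian.Ext (kk R) M i)) :
    ∃ rs : List R, rs.length = n ∧ (∀ r ∈ rs, r ∈ maximalIdeal R) ∧ IsRegular M rs :=
  ModuleCat.exists_isRegular_of_exists_subsingleton_ext (maximalIdeal R) n M (smul_lt M) (kk R)
    supp_kk h

lemma quot_all_zero (M : ModuleCat.{0} R) (rs : List R) :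
    ∀ (N : ModuleCat.{0} R), IsWeaklyRegular N rs → (∀ i, Subsingleton (Abelian.Ext N M i)) →
    ∀ i, Subsingleton
      (Abelian.Ext (ModuleCat.of R (N ⧸ Ideal.ofList rs • (⊤ : Submodule R N))) M i) := by
  induction rs with
  | nil =>
    intro N _ h i
    refine ext_congr_left (LinearEquiv.toModuleIso ?_) M i (h i)
    exact (Submodule.quotEquivOfEqBot _ (by simp)).symm
  | cons x rs ih =>
    intro N hr h i
    rw [isWeaklyRegular_cons_iff] at hr
    have hq := ih (ModuleCat.of R (QuotSMulTop x N)) hr.2 (fun i => by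
      have hs := hr.1.smulShortComplex_shortExact
      cases i with
      | zero => exact con3z hs M (h 0)
      | succ i => exact con3 hs M i (h i) (h (i+1))) i
    refine ext_congr_left (LinearEquiv.toModuleIso ?_) M i hq
    exact (Submodule.quotOfListConsSMulTopEquivQuotSMulTopInner N x rs).symm

lemma supp_eq (N : Type) [AddCommGroup N] [Module R N] [Module.Finite R N] [Nontrivial N]
    (h : Module.supportDim R N ≤ 0) :
    Module.support R N = PrimeSpectrum.zeroLocus (maximalIdeal R) := by
  have hm : closedPoint R ∈ Module.support R N := closedPoint_mem_support R N
  ext p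
  constructor
  · intro hp
    by_contra hcon
    have hlt : p < closedPoint R := by
      refine lt_of_le_of_ne (IsLocalRing.le_maximalIdeal p.2.ne_top) ?_
      rintro rfl
      exact hcon (by simp [PrimeSpectrum.mem_zeroLocus, closedPoint])
    let s : LTSeries (Module.support R N) :=
      ⟨1, fun i => if i = 0 then ⟨p, hp⟩ else ⟨_, hm⟩, by
        intro i; fin_cases i; simpa using hlt⟩
    have := Order.LTSeries.length_le_krullDim s
    have h2 := this.trans h
    have : (1 : WithBot ℕ∞) ≤ 0 := h2
    exact absurd this (by decide)
  · intro hp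
    have : p = closedPoint R := by
      apply PrimeSpectrum.ext
      exact le_antisymm (IsLocalRing.le_maximalIdeal p.2.ne_top) hp
    rw [this]; exact hm

theorem comm_main (d : ℕ) (hdim : ringKrullDim R = d) (n : ℕ)
    (hfid : FID (ModuleCat.of R R) n) (N : ModuleCat.{0} R) [Module.Finite R N] [Nontrivial N]
    (hN : ∀ i < d, Subsingleton (Abelian.Ext (kk R) N i)) :
    FID (ModuleCat.of R R) d ∧ (∀ i, 0 < i → Subsingleton (Abelian.Ext N (ModuleCat.of R R) i)) ∧
    ¬ Subsingleton (Abelian.Ext (kk R) (ModuleCat.of R R) d) := by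
  classical
  have hex : ∃ t, ¬ Subsingleton (Abelian.Ext (kk R) (ModuleCat.of R R) t) := by
    by_contra! hcon
    have h0 : FID (ModuleCat.of R R) 0 := hfid.descend 0 fun i _ _ => hcon i
    have := bump (ModuleCat.of R R) 0 (h0 1 (by omega)) (hcon 0) (ModuleCat.of R R) inferInstance
    have h2 : Subsingleton (R →ₗ[R] R) :=
      ((Abelian.Ext.addEquiv₀.trans ModuleCat.homAddEquiv).symm.subsingleton :
        Subsingleton (ModuleCat.of R R →ₗ[R] ModuleCat.of R R))
    have h3 := congr(($(h2.elim LinearMap.id 0) : R →ₗ[R] R) 1)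
    simp at h3
  obtain ⟨t, ht, hmin⟩ : ∃ t, ¬ Subsingleton (Abelian.Ext (kk R) (ModuleCat.of R R) t) ∧
      ∀ i < t, Subsingleton (Abelian.Ext (kk R) (ModuleCat.of R R) i) :=
    ⟨Nat.find hex, Nat.find_spec hex, fun i hi => not_not.mp (Nat.find_min hex hi)⟩
  have hfid' : FID (ModuleCat.of R R) t := by
    have := fid_of_depth hfid t (ModuleCat.of R R) 0 hmin ht (fun i hi => by
      obtain ⟨i, rfl⟩ : ∃ i', i = i' + 1 := ⟨i - 1, by omega⟩
      exact Abelian.Ext.subsingleton_of_projective _ _ _)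
    simpa using this
  have htd : t ≤ d := by
    obtain ⟨rs, hl, hmem, hreg⟩ := rees_kk (ModuleCat.of R R) t hmin
    have h1 := ringKrullDim_add_length_eq_ringKrullDim_of_isRegular rs hreg
    rw [hdim, hl] at h1
    have hne : Nontrivial (R ⧸ Ideal.ofList rs) := by
      apply Ideal.Quotient.nontrivial_iff.mpr
      have := hreg.2
      intro h; apply this; rw [h]; simp
    have h0 : (0 : WithBot ℕ∞) ≤ ringKrullDim (R ⧸ Ideal.ofList rs) := ringKrullDim_nonneg_of_nontrivial
    have : ((t : ℕ) : WithBot ℕ∞) ≤ (d : ℕ) := by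
      rw [← h1]
      exact le_add_of_nonneg_left h0
    exact_mod_cast this
  have hisch := ischebeck hfid' d N hN
  have hdt : d ≤ t := by
    by_contra! hlt
    have hall : ∀ i, Subsingleton (Abelian.Ext N (ModuleCat.of R R) i) :=
      fun i => hisch i (by omega)
    obtain ⟨rs, hl, hmem, hreg⟩ := rees_kk N d hN
    have hQ := quot_all_zero (ModuleCat.of R R) rs N hreg.1 hall
    have hdimQ := Module.supportDim_add_length_eq_supportDim_of_isRegular rs hreg
    have hnt : Nontrivial (N ⧸ Ideal.ofList rs • (⊤ : Submodule R N)) :=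
      Submodule.Quotient.nontrivial_iff.mpr hreg.2.symm
    have hle : Module.supportDim R (N ⧸ Ideal.ofList rs • (⊤ : Submodule R N)) ≤ 0 := by
      have h1 := Module.supportDim_le_ringKrullDim R N
      rw [← hdimQ, hdim, hl] at h1
      generalize Module.supportDim R (N ⧸ Ideal.ofList rs • (⊤ : Submodule R N)) = a at h1
      induction a with
      | bot => simp
      | coe a =>
        induction a with
        | top => exact absurd h1 (by exact_mod_cast (by simp))
        | coe a =>
          have : a + d ≤ d := by exact_mod_cast h1
          have : a = 0 := by omega
          simp [this]
    have hsupp := supp_eq _ hle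
    obtain ⟨rs', hl', hmem', hreg'⟩ := ModuleCat.exists_isRegular_of_exists_subsingleton_ext
      (maximalIdeal R) (t+1) (ModuleCat.of R R) (smul_lt _) (ModuleCat.of R _) hsupp
      (fun i _ => hQ i)
    exact ht (ModuleCat.subsingleton_ext_of_exists_isRegular (maximalIdeal R) (kk R)
      supp_kk.subset (ModuleCat.of R R) (smul_lt _) rs' hmem' hreg' t (by omega))
  obtain rfl : t = d := le_antisymm htd hdt
  exact ⟨hfid', fun i hi => hisch i (by omega), ht⟩

end Comm
end HD

namespace HD
open Abelian

section Lift
variable {C : Type 1} [Category.{0} C] [Abelian C] [HasExt.{0} C]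

lemma inj_sub (X Y : C) [Injective Y] (i : ℕ) : Subsingleton (Abelian.Ext X Y (i+1)) :=
  HasInjectiveDimensionLT.subsingleton Y 1 (i+1) (by omega) X

lemma lift_of_ext {T : ShortComplex C} (h : T.ShortExact) (X : C)
    (h1 : Subsingleton (Abelian.Ext X T.X₁ 1)) (φ : X ⟶ T.X₃) : ∃ ψ : X ⟶ T.X₂, ψ ≫ T.g = φ := by
  obtain ⟨y, hy⟩ := Abelian.Ext.covariant_sequence_exact₃ X h (Abelian.Ext.mk₀ φ) (zero_add 1)
    (Subsingleton.elim _ _)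
  obtain ⟨ψ, rfl⟩ := Abelian.Ext.homEquiv₀.symm.surjective y
  exact ⟨ψ, Abelian.Ext.homEquiv₀.symm.injective (by simpa using hy)⟩

lemma ext_of_lift {T : ShortComplex C} (h : T.ShortExact) [Injective T.X₂] (X : C)
    (h1 : ∀ φ : X ⟶ T.X₃, ∃ ψ : X ⟶ T.X₂, ψ ≫ T.g = φ) : Subsingleton (Abelian.Ext X T.X₁ 1) := by
  refine subsingleton_of_forall_eq 0 fun x => ?_
  have := inj_sub X T.X₂ 0
  obtain ⟨y, rfl⟩ := Abelian.Ext.covariant_sequence_exact₁ X h x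
    (Subsingleton.elim _ _) (zero_add 1)
  obtain ⟨φ, rfl⟩ := Abelian.Ext.homEquiv₀.symm.surjective y
  obtain ⟨ψ, rfl⟩ := h1 φ
  simp [Abelian.Ext.homEquiv₀_symm_apply, ← Abelian.Ext.mk₀_comp_mk₀]

end Lift

section Adj
variable {C : Type 1} [Category.{0} C] [Abelian C] [HasExt.{0} C] [EnoughInjectives C]
variable {D : Type 1} [Category.{0} D] [Abelian D] [HasExt.{0} D]

lemma adj_ext {F : D ⥤ C} {G : C ⥤ D} (adj : F ⊣ G) [F.PreservesMonomorphisms]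
    [G.PreservesZeroMorphisms] (Q : C)
    (hQ : ∀ T : ShortComplex C, T.ShortExact → Subsingleton (Abelian.Ext Q T.X₁ 1) →
      (T.map G).ShortExact) (X : D) (n : ℕ) : ∀ (M : C)
    (_ : ∀ i, Subsingleton (Abelian.Ext Q M (i+1))),
    (Subsingleton (Abelian.Ext X (G.obj M) (n+1)) ↔ Subsingleton (Abelian.Ext (F.obj X) M (n+1))) := by
  induction n with
  | zero =>
    intro M hM
    obtain ⟨ip⟩ := EnoughInjectives.presentation M
    have hT := ip.shortExact_shortComplex
    have hT' := hQ _ hT (hM 0)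
    have i2 : Injective ip.shortComplex.X₂ := ip.injective
    have i2' : Injective (ip.shortComplex.map G).X₂ := adj.map_injective _ i2
    constructor
    · intro h
      refine ext_of_lift hT _ fun φ => ?_
      obtain ⟨ψ, hψ⟩ := lift_of_ext hT' X h (adj.homEquiv _ _ φ)
      refine ⟨(adj.homEquiv _ _).symm ψ, ?_⟩
      apply (adj.homEquiv _ _).injective
      refine (adj.homEquiv_naturality_right _ ip.shortComplex.g).trans ?_
      exact (congrArg (fun t => t ≫ G.map ip.shortComplex.g)
        (Equiv.apply_symm_apply (adj.homEquiv _ _) ψ)).trans hψ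
    · intro h
      refine ext_of_lift hT' _ fun φ => ?_
      obtain ⟨ψ, hψ⟩ := lift_of_ext hT (F.obj X) h ((adj.homEquiv _ _).symm φ)
      refine ⟨adj.homEquiv _ _ ψ, ?_⟩
      have := adj.homEquiv_naturality_right ψ ip.shortComplex.g
      rw [hψ] at this
      exact this.symm.trans (Equiv.apply_symm_apply _ _)
  | succ n ih =>
    intro M hM
    obtain ⟨ip⟩ := EnoughInjectives.presentation M
    have hT := ip.shortExact_shortComplex
    have hT' := hQ _ hT (hM 0)
    have i2 : Injective ip.shortComplex.X₂ := ip.injective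
    have i2' : Injective (ip.shortComplex.map G).X₂ := adj.map_injective _ i2
    have key := ih ip.shortComplex.X₃ fun i => cov3 hT Q (i+1) (inj_sub _ _ _) (hM (i+1))
    constructor
    · intro h
      exact cov1 hT _ _ (key.1 (cov3 hT' X (n+1) (inj_sub _ _ _) h)) (inj_sub _ _ _)
    · intro h
      exact cov1 hT' _ _ (key.2 (cov3 hT _ (n+1) (inj_sub _ _ _) h)) (inj_sub _ _ _)
end Adj

section BaerS
variable {A : Type} [Ring A]

lemma baer_inj (M : ModuleCat.{0} A)
    (h : ∀ J : Ideal A, Subsingleton (Abelian.Ext (ModuleCat.of A (A ⧸ J)) M 1)) : Injective M := by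
  rw [← Module.injective_iff_injective_object A M, ← Module.Baer.iff_injective]
  intro J g
  let T : ShortComplex (ModuleCat.{0} A) := ShortComplex.mk (ModuleCat.ofHom J.subtype)
    (ModuleCat.ofHom J.mkQ) (by ext x; simp)
  have hT : T.ShortExact := ModuleCat.shortComplex_shortExact T
    (LinearMap.exact_subtype_mkQ J) J.injective_subtype J.mkQ_surjective
  obtain ⟨φ, hφ⟩ := Abelian.Ext.contravariant_sequence_exact₁ hT M
    (Abelian.Ext.mk₀ (ModuleCat.ofHom g)) (add_comm 1 0) ((h J).elim _ _)
  obtain ⟨φ, rfl⟩ := Abelian.Ext.homEquiv₀.symm.surjective φ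
  have h2 : T.f ≫ φ = ModuleCat.ofHom g := Abelian.Ext.homEquiv₀.symm.injective (by simpa using hφ)
  refine ⟨φ.hom, fun x hx => ?_⟩
  have := congrArg (fun f => f.hom ⟨x, hx⟩) h2
  exact this

lemma baer_dim (n : ℕ) : ∀ (M : ModuleCat.{0} A)
    (_ : ∀ J : Ideal A, Subsingleton (Abelian.Ext (ModuleCat.of A (A ⧸ J)) M (n+1))),
    HasInjectiveDimensionLT M (n+1) := by
  induction n with
  | zero => 
    intro M h
    have := baer_inj M h
    infer_instance
  | succ n ih =>
    intro M h
    obtain ⟨ip⟩ := EnoughInjectives.presentation M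
    have hT := ip.shortExact_shortComplex
    have i2 : Injective ip.shortComplex.X₂ := ip.injective
    exact (hT.hasInjectiveDimensionLT_X₃_iff n i2).1
      (ih _ fun J => cov3 hT _ (n+1) (inj_sub _ _ _) (h J))
end BaerS
end HD

namespace HD
open Abelian ModuleCat

section Coext
variable {S : Type} [CommRing S] {Γ : Type} [Ring Γ] [Algebra S Γ]

noncomputable abbrev FF (S : Type) [CommRing S] (Γ : Type) [Ring Γ] [Algebra S Γ] :
    ModuleCat.{0} Γ ⥤ ModuleCat.{0} S := ModuleCat.restrictScalars.{0} (algebraMap S Γ)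
noncomputable abbrev GG (S : Type) [CommRing S] (Γ : Type) [Ring Γ] [Algebra S Γ] :
    ModuleCat.{0} S ⥤ ModuleCat.{0} Γ := ModuleCat.coextendScalars (algebraMap S Γ)

noncomputable def adjS : FF S Γ ⊣ GG S Γ := ModuleCat.restrictCoextendScalarsAdj (algebraMap S Γ)

instance : (FF S Γ).PreservesMonomorphisms := inferInstance
instance : (GG S Γ).Additive := (adjS (S := S) (Γ := Γ)).right_adjoint_additive
instance : (GG S Γ).IsRightAdjoint := (adjS (S := S) (Γ := Γ)).isRightAdjoint

lemma coext_exact (T : ShortComplex (ModuleCat.{0} S)) (hT : T.ShortExact)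
    (h : Subsingleton (Abelian.Ext ((FF S Γ).obj (ModuleCat.of Γ Γ)) T.X₁ 1)) :
    (T.map (GG S Γ)).ShortExact := by
  have := hT.mono_f
  have e1 : (T.map (GG S Γ)).Exact ∧ Mono (GG S Γ |>.map T.f) :=
    ⟨(hT.exact.map_of_mono_of_preservesKernel (GG S Γ) inferInstance inferInstance), inferInstance⟩
  refine { exact := e1.1, mono_f := e1.2, epi_g := ?_ }
  rw [ModuleCat.epi_iff_surjective]
  intro y
  let φ : ModuleCat.of Γ Γ ⟶ (GG S Γ).obj T.X₃ := ModuleCat.ofHom (LinearMap.toSpanSingleton Γ _ y)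
  obtain ⟨ψ, hψ⟩ := lift_of_ext hT _ h ((adjS.homEquiv _ _).symm φ)
  have h3 : (adjS.homEquiv _ _ ψ) ≫ (GG S Γ).map T.g = φ := by
    rw [← Adjunction.homEquiv_naturality_right, hψ, Equiv.apply_symm_apply]
  refine ⟨(adjS.homEquiv _ _ ψ).hom (1 : Γ), ?_⟩
  have := congrArg (fun f => f.hom (1 : Γ)) h3
  refine Eq.trans this ?_
  exact one_smul Γ y

lemma coext_ext (X : ModuleCat.{0} Γ) (n : ℕ)
    (h : ∀ i, Subsingleton (Abelian.Ext ((FF S Γ).obj (ModuleCat.of Γ Γ)) (ModuleCat.of S S) (i+1))) :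
    Subsingleton (Abelian.Ext X ((GG S Γ).obj (ModuleCat.of S S)) (n+1)) ↔
      Subsingleton (Abelian.Ext ((FF S Γ).obj X) (ModuleCat.of S S) (n+1)) :=
  adj_ext adjS _ coext_exact X n _ h

noncomputable def ffEquiv : ((FF S Γ).obj (ModuleCat.of Γ Γ)) ≃ₗ[S] Γ where
  toFun x := (show Γ from x)
  invFun x := (show Γ from x)
  left_inv _ := rfl
  right_inv _ := rfl
  map_add' _ _ := rfl
  map_smul' s x := (Algebra.smul_def s (show Γ from x)).symm

noncomputable def ffIso : (FF S Γ).obj (ModuleCat.of Γ Γ) ≅ ModuleCat.of S Γ :=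
  ffEquiv.toModuleIso

lemma ff_finite [Module.Finite S Γ] (X : ModuleCat.{0} Γ) [Module.Finite Γ X] :
    Module.Finite S ((FF S Γ).obj X) := by
  let _ : Module S X := Module.compHom X (algebraMap S Γ)
  have : IsScalarTower S Γ X := ⟨fun s g x => by
    rw [Algebra.smul_def, mul_smul]; rfl⟩
  exact (Module.Finite.trans Γ X : Module.Finite S X)

end Coext

section Main
open IsLocalRing
variable {S : Type} [CommRing S] [IsNoetherianRing S] [IsLocalRing S]
  {Γ : Type} [Ring Γ] [Algebra S Γ] [Module.Finite S Γ] [Nontrivial Γ]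

lemma coext_main (d n : ℕ) (hdim : ringKrullDim S = d) (hfid : FID (ModuleCat.of S S) n)
    (hN : ∀ i < d, Subsingleton (Abelian.Ext (kk S) (ModuleCat.of S Γ) i)) :
    HasInjectiveDimensionLT ((GG S Γ).obj (ModuleCat.of S S)) (d+1) ∧
    ∀ m < d, ¬ HasInjectiveDimensionLT ((GG S Γ).obj (ModuleCat.of S S)) (m+1) := by
  obtain ⟨h1, h2, h3⟩ := comm_main d hdim n hfid (ModuleCat.of S Γ) hN
  have hq : ∀ i, Subsingleton (Abelian.Ext ((FF S Γ).obj (ModuleCat.of Γ Γ)) (ModuleCat.of S S) (i+1)) :=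
    fun i => ext_congr_left ffIso.symm _ _ (h2 (i+1) (by omega))
  constructor
  · refine baer_dim d _ fun J => ?_
    rw [coext_ext _ _ hq]
    exact h1 (d+1) (by omega) _ (ff_finite _)
  · intro m hm hinj
    obtain ⟨e, rfl⟩ : ∃ e, d = e + 1 := ⟨d - 1, by omega⟩
    let J : Ideal Γ :=
      { (maximalIdeal S • (⊤ : Submodule S Γ)).toAddSubmonoid with
        smul_mem' := fun c x hx => by
          change c * x ∈ maximalIdeal S • (⊤ : Submodule S Γ)
          replace hx : x ∈ maximalIdeal S • (⊤ : Submodule S Γ) := hx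
          refine Submodule.smul_induction_on hx ?_ ?_
          · intro r hr n _
            rw [mul_smul_comm]
            exact Submodule.smul_mem_smul hr trivial
          · intro x y hx hy
            rw [mul_add]; exact add_mem hx hy }
    have hJm : ∀ x, x ∈ J ↔ x ∈ maximalIdeal S • (⊤ : Submodule S Γ) := fun x => Iff.rfl
    have hJ : (1 : Γ) ∉ J := by
      intro h1
      have h4 := (Ideal.eq_top_iff_one J).2 h1
      refine (smul_lt (R := S) (ModuleCat.of S Γ)).ne ?_
      refine eq_top_iff.2 fun x _ => ?_
      exact (hJm x).1 (h4 ▸ trivial)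
    let X := ModuleCat.of Γ (Γ ⧸ J)
    have hX := (coext_ext X e hq).1 (HasInjectiveDimensionLT.subsingleton _ (m+1) (e+1) (by omega) X)
    have hfin := ff_finite (S := S) X
    apply h3
    let f0 : S →ₗ[S] (FF S Γ).obj X := LinearMap.toSpanSingleton S ((FF S Γ).obj X) (J.mkQ 1)
    have hker : maximalIdeal S ≤ LinearMap.ker f0 := by
      intro s hs
      rw [LinearMap.mem_ker]
      change J.mkQ ((algebraMap S Γ s) • 1) = 0
      rw [Submodule.mkQ_apply, Submodule.Quotient.mk_eq_zero, hJm, smul_eq_mul, ← Algebra.smul_def]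
      exact Submodule.smul_mem_smul hs trivial
    refine kk_embed ((FF S Γ).obj X) (Submodule.liftQ _ f0 hker) ?_ _ _ hX
      (fun N hN => h1 _ (by omega) N hN)
    intro h0
    apply hJ
    have h5 : f0 1 = 0 := by
      have := congrArg (fun f => f (Submodule.Quotient.mk 1)) h0
      exact this
    have h6 : J.mkQ ((algebraMap S Γ 1) • 1) = 0 := h5
    rw [map_one, one_smul, Submodule.mkQ_apply, Submodule.Quotient.mk_eq_zero] at h6
    exact h6
end Main
end HD

namespace HD
open Abelian ModuleCat

section Isos
variable {S : Type} [CommRing S] {Γ : Type} [Ring Γ] [Algebra S Γ]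

noncomputable def leftEquiv :
    (Γ →ₗ[S] S) ≃ₗ[Γ] ((ModuleCat.restrictScalars (algebraMap S Γ)).obj (ModuleCat.of Γ Γ) →ₗ[S] S) where
  toFun f := f.comp (ffEquiv (S := S) (Γ := Γ)).toLinearMap
  invFun f := f.comp (ffEquiv (S := S) (Γ := Γ)).symm.toLinearMap
  left_inv f := by ext; rfl
  right_inv f := by ext; rfl
  map_add' f g := rfl
  map_smul' γ f := by ext; rfl

noncomputable def leftIso :
    ModuleCat.of Γ (Γ →ₗ[S] S) ≅ (GG S Γ).obj (ModuleCat.of S S) :=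
  (leftEquiv.trans (CoextendScalars.equiv (algebraMap S Γ) (ModuleCat.of S S)).symm).toModuleIso

noncomputable def rightEquiv :
    (Γ →ₗ[S] S) ≃ₗ[Γᵐᵒᵖ]
      ((ModuleCat.restrictScalars (algebraMap S Γᵐᵒᵖ)).obj (ModuleCat.of Γᵐᵒᵖ Γᵐᵒᵖ) →ₗ[S] S) where
  toFun f := (f.comp (MulOpposite.opLinearEquiv S).symm.toLinearMap).comp
    (ffEquiv (S := S) (Γ := Γᵐᵒᵖ)).toLinearMap
  invFun f := (f.comp (ffEquiv (S := S) (Γ := Γᵐᵒᵖ)).symm.toLinearMap).comp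
    (MulOpposite.opLinearEquiv S).toLinearMap
  left_inv f := by ext; rfl
  right_inv f := by ext; rfl
  map_add' f g := rfl
  map_smul' γ f := by ext; rfl

noncomputable def rightIso :
    ModuleCat.of Γᵐᵒᵖ (Γ →ₗ[S] S) ≅ (GG S Γᵐᵒᵖ).obj (ModuleCat.of S S) :=
  (rightEquiv.trans
    (CoextendScalars.equiv (algebraMap S Γᵐᵒᵖ) (ModuleCat.of S S)).symm).toModuleIso
end Isos

lemma injdim_congr {A : Type} [Ring A] {M N : ModuleCat.{0} A} (e : M ≅ N) (n : ℕ)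
    (h : HasInjectiveDimensionLT M n) : HasInjectiveDimensionLT N n := by
  refine HasInjectiveDimensionLT.mk fun i hi Y x => ?_
  exact (ext_congr_right e Y i (HasInjectiveDimensionLT.subsingleton M n i hi Y)).elim _ _

section Main
open IsLocalRing
variable {S : Type} [CommRing S] [IsNoetherianRing S] [IsLocalRing S]
  {Γ : Type} [Ring Γ] [Algebra S Γ] [Module.Finite S Γ] [Nontrivial Γ]

lemma main_left (d n : ℕ) (hdim : ringKrullDim S = d) (hfid : FID (ModuleCat.of S S) n)
    (hN : ∀ i < d, Subsingleton (Abelian.Ext (kk S) (ModuleCat.of S Γ) i)) :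
    HasInjectiveDimensionLT (ModuleCat.of Γ (Γ →ₗ[S] S)) (d+1) ∧
    ∀ m < d, ¬ HasInjectiveDimensionLT (ModuleCat.of Γ (Γ →ₗ[S] S)) (m+1) := by
  have h := coext_main d n hdim hfid hN
  exact ⟨injdim_congr leftIso.symm _ h.1, fun m hm h' => h.2 m hm (injdim_congr leftIso _ h')⟩

lemma main_right (d n : ℕ) (hdim : ringKrullDim S = d) (hfid : FID (ModuleCat.of S S) n)
    (hN : ∀ i < d, Subsingleton (Abelian.Ext (kk S) (ModuleCat.of S Γ) i)) :
    HasInjectiveDimensionLT (ModuleCat.of Γᵐᵒᵖ (Γ →ₗ[S] S)) (d+1) ∧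
    ∀ m < d, ¬ HasInjectiveDimensionLT (ModuleCat.of Γᵐᵒᵖ (Γ →ₗ[S] S)) (m+1) := by
  have : Module.Finite S Γᵐᵒᵖ := Module.Finite.equiv (MulOpposite.opLinearEquiv S)
  have h := coext_main (Γ := Γᵐᵒᵖ) d n hdim hfid fun i hi =>
    ext_congr_right (MulOpposite.opLinearEquiv S : Γ ≃ₗ[S] Γᵐᵒᵖ).toModuleIso _ _ (hN i hi)
  exact ⟨injdim_congr rightIso.symm _ h.1, fun m hm h' => h.2 m hm (injdim_congr rightIso _ h')⟩
end Main
end HD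

namespace HD
open Abelian

section Conv
variable {A : Type} [Ring A]

lemma ext_of_extGroup (n : ℕ) (X Y : ModuleCat.{0} A) (h : Subsingleton (extGroup A n X Y)) :
    Subsingleton (Abelian.Ext X Y n) := by
  obtain ⟨P⟩ : Nonempty (ProjectiveResolution X) := ⟨projectiveResolution X⟩
  have h0 : Limits.IsZero ((P.complex.linearYonedaObj ℤ Y).homology n) :=
    Limits.IsZero.of_iso (ModuleCat.isZero_of_subsingleton (extGroup A n X Y)) (P.isoExt n Y).symm
  rw [← HomologicalComplex.exactAt_iff_isZero_homology] at h0
  refine subsingleton_of_forall_eq 0 fun α => ?_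
  obtain ⟨f, hf, rfl⟩ := P.extMk_surjective α (n+1) rfl
  cases n with
  | zero =>
    rw [HomologicalComplex.exactAt_iff' _ 0 0 1 (by simp) (by simp), ShortComplex.moduleCat_exact_iff] at h0
    obtain ⟨y, hy⟩ := h0 f hf
    have hz : (P.complex.linearYonedaObj ℤ Y).d 0 0 = 0 := HomologicalComplex.shape _ _ _ (by simp)
    have : f = 0 := by
      refine hy.symm.trans ?_
      change (P.complex.linearYonedaObj ℤ Y).d 0 0 y = 0
      rw [hz]; rfl
    subst this
    exact P.extMk_zero _ _
  | succ p =>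
    rw [HomologicalComplex.exactAt_iff' _ p (p+1) (p+1+1) (by simp) (by simp), ShortComplex.moduleCat_exact_iff] at h0
    obtain ⟨y, hy⟩ := h0 f hf
    rw [P.extMk_eq_zero_iff f _ rfl hf p rfl]
    exact ⟨y, hy⟩

lemma extGroup_of_sub (n : ℕ) (X Y : ModuleCat.{0} A) (h : Subsingleton Y) :
    Subsingleton (extGroup A n X Y) := by
  obtain ⟨P⟩ : Nonempty (ProjectiveResolution X) := ⟨projectiveResolution X⟩
  have h0 : Limits.IsZero ((P.complex.linearYonedaObj ℤ Y).homology n) := by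
    rw [← HomologicalComplex.exactAt_iff_isZero_homology, HomologicalComplex.exactAt_iff]
    refine ShortComplex.exact_of_isZero_X₂ _ ?_
    have : Subsingleton ((P.complex.linearYonedaObj ℤ Y).sc n).X₂ := 
      ⟨fun a b => (ModuleCat.isZero_of_subsingleton Y).eq_of_tgt (Y := P.complex.X n) a b⟩
    exact ModuleCat.isZero_of_subsingleton _
  exact ModuleCat.subsingleton_of_isZero (h0.of_iso (P.isoExt n Y))

lemma dim_of_le (M : ModuleCat.{0} A) (n : ℕ) (h : hasInjDimLE A M n) :
    HasInjectiveDimensionLT M (n+1) := by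
  obtain ⟨I, hI⟩ := h
  refine HasInjectiveDimensionLT.mk fun i hi Y x => ?_
  obtain ⟨f, hf, rfl⟩ := I.extMk_surjective x (i+1) rfl
  obtain rfl : f = 0 := (hI i (by omega)).eq_of_tgt _ _
  exact I.extMk_zero _ _

end Conv

end HD

namespace HD
open Abelian

section Splice
variable {A : Type} [Ring A] {M N I : ModuleCat.{0} A}

lemma ker_iota (J : InjectiveResolution N) (f : N ⟶ J.cocomplex.X 0) (hf : f = J.ι.f 0) :
    ∃ w : f ≫ J.cocomplex.d 0 1 = 0, (ShortComplex.mk f (J.cocomplex.d 0 1) w).Exact ∧ Mono f := by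
  subst hf
  refine ⟨J.ι_f_zero_comp_complex_d, ?_, inferInstanceAs (Mono (J.ι.f 0))⟩
  exact ShortComplex.exact_of_f_is_kernel _ J.isLimitKernelFork

lemma splice (f : M ⟶ I) (g : I ⟶ N) (w : f ≫ g = 0) (hs : (ShortComplex.mk f g w).ShortExact)
    [hI : Injective I] (J : InjectiveResolution N) (n : ℕ)
    (hJ : ∀ k, n < k → Limits.IsZero (J.cocomplex.X k)) : hasInjDimLE A M (n+1) := by
  obtain ⟨w1, e1, m1⟩ := ker_iota J (J.ι.f 0) rfl
  set u : N ⟶ J.cocomplex.X 0 := J.ι.f 0 with hu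
  have hmono := hs.mono_f
  have hepi := hs.epi_g
  have w2 : (g ≫ u) ≫ J.cocomplex.d 0 1 = 0 := by rw [Category.assoc, w1, Limits.comp_zero]
  have w3 : f ≫ g ≫ u = 0 := by rw [← Category.assoc, w, Limits.zero_comp]
  have ex0 : (ShortComplex.mk f (g ≫ u) w3).Exact := by
    rw [ShortComplex.moduleCat_exact_iff]
    intro x hx
    have := hs.exact
    rw [ShortComplex.moduleCat_exact_iff] at this
    exact this x ((ModuleCat.mono_iff_injective u).1 m1 (hx.trans (map_zero _).symm))
  have ex1 : (ShortComplex.mk (g ≫ u) (J.cocomplex.d 0 1) w2).Exact := by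
    rw [ShortComplex.moduleCat_exact_iff] at e1 ⊢
    intro x hx
    obtain ⟨y, hy⟩ := e1 x hx
    obtain ⟨z, hz⟩ := (ModuleCat.epi_iff_surjective g).1 hepi y
    refine ⟨z, ?_⟩
    refine Eq.trans ?_ hy
    exact congrArg u hz
  let K := CochainComplex.augment J.cocomplex (g ≫ u) w2
  have hK : ∀ k, K.ExactAt (k+1) := by
    intro k
    rw [HomologicalComplex.exactAt_iff' _ k (k+1) (k+2) (by simp) (by simp)]
    cases k with
    | zero => exact ex1
    | succ k => exact J.exact_succ k
  have hd : K.d 0 1 = g ≫ u := rfl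
  have w4 : f ≫ K.d 0 1 = 0 := w3
  let ι : (CochainComplex.single₀ (ModuleCat.{0} A)).obj M ⟶ K :=
    (CochainComplex.fromSingle₀Equiv K M).symm ⟨f, w4⟩
  have hq : QuasiIso ι := by
    refine ⟨fun n => ?_⟩
    cases n with
    | zero =>
      rw [CochainComplex.quasiIsoAt₀_iff, ShortComplex.quasiIso_iff_of_zeros]
      · refine (ShortComplex.exact_and_mono_f_iff_of_iso ?_).2 ⟨ex0, hmono⟩
        exact ShortComplex.isoMk (Iso.refl _) (Iso.refl _) (Iso.refl _) (by simp; rfl) (by simp; rfl)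
      all_goals rfl
    | succ n =>
      rw [quasiIsoAt_iff_exactAt]
      · exact hK n
      · apply CochainComplex.exactAt_succ_single_obj
  refine ⟨{ cocomplex := K, ι := ι, quasiIso := hq, injective := ?_ }, ?_⟩
  · intro k
    cases k with
    | zero => exact hI
    | succ k => exact J.injective k
  · intro k hk
    cases k with
    | zero => omega
    | succ k => exact hJ k (by omega)

lemma le_of_dim (n : ℕ) : ∀ M : ModuleCat.{0} A, HasInjectiveDimensionLT M (n+1) →
    hasInjDimLE A M n := by
  induction n with
  | zero =>
    intro M h
    have := injective_iff_hasInjectiveDimensionLT_one.2 h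
    refine ⟨InjectiveResolution.self M, fun k hk => ?_⟩
    exact HomologicalComplex.isZero_single_obj_X _ _ _ _ (by omega)
  | succ n ih =>
    intro M h
    obtain ⟨ip⟩ := EnoughInjectives.presentation M
    have hT := ip.shortExact_shortComplex
    have i2 : Injective ip.shortComplex.X₂ := ip.injective
    obtain ⟨J, hJ⟩ := ih _ ((hT.hasInjectiveDimensionLT_X₃_iff n i2).2 h)
    exact splice _ _ _ hT (hI := i2) J n hJ
end Splice
end HD

/-- Let `(S, 𝔪)` be a commutative noetherian local Gorenstein ring of
Krull dimension `d`, and let `Γ` be an `S`-algebra, finitely generated and maximal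
Cohen–Macaulay as an `S`-module.  Then the left `Γ`-module `Hom_S(Γ, S)` has injective
dimension exactly `d`, and likewise as a right `Γ`-module. -/
theorem homDual_injDim_eq_krullDim
    (S : Type) [CommRing S] [IsNoetherianRing S] [IsLocalRing S]
    (d : ℕ)
    (hdim : ringKrullDim S = d)
    (hGor : ∃ m : ℕ, hasInjDimLE S (ModuleCat.of S S) m)
    (Γ : Type) [Ring Γ] [Algebra S Γ] [Module.Finite S Γ]
    (hMCM : moduleDepth S (ModuleCat.of S Γ) = (d : ℕ∞)) :
    (hasInjDimLE Γ (ModuleCat.of Γ (Γ →ₗ[S] S)) d ∧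
      ∀ m : ℕ, hasInjDimLE Γ (ModuleCat.of Γ (Γ →ₗ[S] S)) m → d ≤ m) ∧
    (hasInjDimLE Γᵐᵒᵖ (ModuleCat.of Γᵐᵒᵖ (Γ →ₗ[S] S)) d ∧
      ∀ m : ℕ, hasInjDimLE Γᵐᵒᵖ (ModuleCat.of Γᵐᵒᵖ (Γ →ₗ[S] S)) m → d ≤ m) := by
  obtain ⟨n, hn⟩ := hGor
  have hn' := HD.dim_of_le _ _ hn
  have hfid : HD.FID (ModuleCat.of S S) n := fun i hi N _ =>
    HasInjectiveDimensionLT.subsingleton _ (n+1) i hi N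
  have hN : ∀ i < d, Subsingleton (Abelian.Ext (HD.kk S) (ModuleCat.of S Γ) i) := by
    intro i hi
    refine HD.ext_of_extGroup i _ _ ?_
    by_contra hc
    rw [not_subsingleton_iff_nontrivial] at hc
    have h1 : moduleDepth S (ModuleCat.of S Γ) ≤ (i : ℕ∞) := sInf_le ⟨i, rfl, hc⟩
    rw [hMCM] at h1
    have h2 : d ≤ i := by exact_mod_cast h1
    omega
  have hnt : Nontrivial Γ := by
    by_contra hc
    rw [not_nontrivial_iff_subsingleton] at hc
    have h1 : (⊤ : ℕ∞) ≤ moduleDepth S (ModuleCat.of S Γ) := by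
      refine le_sInf ?_
      rintro _ ⟨i, rfl, h⟩
      exact absurd h (not_nontrivial_iff_subsingleton.2 (HD.extGroup_of_sub _ _ _ hc))
    rw [hMCM] at h1
    exact absurd (top_le_iff.1 h1) (ENat.coe_ne_top d)
  obtain ⟨a1, a2⟩ := HD.main_left (Γ := Γ) d n hdim hfid hN
  obtain ⟨b1, b2⟩ := HD.main_right (Γ := Γ) d n hdim hfid hN
  refine ⟨⟨HD.le_of_dim _ _ a1, fun m hm => ?_⟩, HD.le_of_dim _ _ b1, fun m hm => ?_⟩
  · by_contra hlt
    exact a2 m (by omega) (HD.dim_of_le _ _ hm)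
  · by_contra hlt
    exact b2 m (by omega) (HD.dim_of_le _ _ hm)
end

section
/- Let (S, 𝔪) be a commutative noetherian local Gorenstein ring of Krull dimension d, and let Γ be an S-algebra that is finitely generated as an S-module and is maximal Cohen–Macaulay as an S-module. Let X be a nonzero finitely generated left Γ-module that is maximal Cohen–Macaulay as an S-module (depth_S X = d). Then the injective dimension of X as a left Γ-module equals the projective dimension of the right Γ-module Hom_S(X, S) plus d; in particular, one of these dimensions is finite if and only if the other is. -/
open CategoryTheory

section Part0

open CategoryTheory Abelian Limits

section P0
universe v u
variable {C : Type u} [Category.{v} C] [Abelian C]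

lemma mkInjRes_aux (M : C) (K : CochainComplex C ℕ) (j : M ⟶ K.X 0) (w : j ≫ K.d 0 1 = 0)
    [Mono j] (h0 : (ShortComplex.mk j (K.d 0 1) w).Exact)
    (h : ∀ n, (ShortComplex.mk (K.d n (n+1)) (K.d (n+1) (n+2)) (K.d_comp_d _ _ _)).Exact) :
    QuasiIso ((CochainComplex.fromSingle₀Equiv K M).symm ⟨j, w⟩) := ⟨fun n => by
    cases n with
    | zero =>
      rw [CochainComplex.quasiIsoAt₀_iff, ShortComplex.quasiIso_iff_of_zeros]
      · refine (ShortComplex.exact_and_mono_f_iff_of_iso ?_).2 ⟨h0, by dsimp; infer_instance⟩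
        refine ShortComplex.isoMk (Iso.refl _) (Iso.refl _) (Iso.refl _) ?_ ?_
        · refine (Category.id_comp _).trans ?_
          refine Eq.trans ?_ (Category.comp_id _).symm
          exact (CochainComplex.fromSingle₀Equiv_symm_apply_f_zero (C := K) j w).symm
        · exact (Category.id_comp _).trans (Category.comp_id _).symm
      · exact ((CochainComplex.single₀ C).obj M).shape 0 0 (by simp)
      · exact (HomologicalComplex.isZero_single_obj_X (ComplexShape.up ℕ) 0 M 1
          (by simp)).eq_of_tgt _ _
      · exact K.shape 0 0 (by simp)
    | succ n =>
      rw [quasiIsoAt_iff_exactAt]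
      · rw [HomologicalComplex.exactAt_iff' _ n (n + 1) (n + 1 + 1) (by simp) (by simp)]
        exact h n
      · apply CochainComplex.exactAt_succ_single_obj⟩

/-- build an injective resolution -/
noncomputable def mkInjRes (M : C) (K : CochainComplex C ℕ) (j : M ⟶ K.X 0) (w : j ≫ K.d 0 1 = 0)
    (hj : Mono j) (h0 : (ShortComplex.mk j (K.d 0 1) w).Exact)
    (h : ∀ n, (ShortComplex.mk (K.d n (n+1)) (K.d (n+1) (n+2)) (K.d_comp_d _ _ _)).Exact)
    (hK : ∀ n, Injective (K.X n)) : InjectiveResolution M where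
  cocomplex := K
  injective := hK
  ι := (CochainComplex.fromSingle₀Equiv K M).symm ⟨j, w⟩
  quasiIso := mkInjRes_aux M K j w h0 h

lemma exact_comp_mono_aux (T : ShortComplex C) {Z : C} (j : T.X₃ ⟶ Z) [Mono j] (hT : T.Exact) :
    (ShortComplex.mk T.f (T.g ≫ j) (by rw [← Category.assoc, T.zero, zero_comp])).Exact := by
  let φ : T ⟶ (ShortComplex.mk T.f (T.g ≫ j) (by rw [← Category.assoc, T.zero, zero_comp])) :=
    ShortComplex.homMk (𝟙 _) (𝟙 _) j (by simp) (by simp)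
  have e1 : Epi φ.τ₁ := inferInstanceAs (Epi (𝟙 _))
  have e2 : IsIso φ.τ₂ := inferInstanceAs (IsIso (𝟙 _))
  have e3 : Mono φ.τ₃ := inferInstanceAs (Mono j)
  exact (ShortComplex.exact_iff_of_epi_of_isIso_of_mono φ).1 hT

lemma exact_epi_comp_aux {X Y : C} (p : X ⟶ Y) [Epi p] {Z W : C} (j : Y ⟶ Z) (g : Z ⟶ W)
    (w : j ≫ g = 0) (hT : (ShortComplex.mk j g w).Exact) :
    (ShortComplex.mk (p ≫ j) g (by rw [Category.assoc, w, comp_zero])).Exact := by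
  let φ : (ShortComplex.mk (p ≫ j) g (by rw [Category.assoc, w, comp_zero])) ⟶
      (ShortComplex.mk j g w) :=
    ShortComplex.homMk p (𝟙 _) (𝟙 _) (by simp) (by simp)
  have e1 : Epi φ.τ₁ := inferInstanceAs (Epi p)
  have e2 : IsIso φ.τ₂ := inferInstanceAs (IsIso (𝟙 _))
  have e3 : Mono φ.τ₃ := inferInstanceAs (Mono (𝟙 _))
  exact (ShortComplex.exact_iff_of_epi_of_isIso_of_mono φ).2 hT

lemma injRes_data {Z : C} (J : InjectiveResolution Z) : ∃ (j : Z ⟶ J.cocomplex.X 0) (w : j ≫ J.cocomplex.d 0 1 = 0)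
    , Mono j ∧ (ShortComplex.mk j (J.cocomplex.d 0 1) w).Exact := by
  refine ⟨J.ι.f 0, J.ι_f_zero_comp_complex_d, inferInstanceAs (Mono (J.ι.f 0)), ?_⟩
  exact ShortComplex.exact_of_f_is_kernel _ J.isLimitKernelFork

/-- Splicing an injective resolution. -/
lemma spliceInj (T : ShortComplex C) (hT : T.ShortExact) (hI : Injective T.X₂)
    (J : InjectiveResolution T.X₃) : ∃ (I : InjectiveResolution T.X₁), 
      ∀ n, I.cocomplex.X (n+1) = J.cocomplex.X n := by
  obtain ⟨j, w, hj, hex⟩ := injRes_data J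
  have := hT.mono_f
  have := hT.epi_g
  refine ⟨mkInjRes T.X₁ (CochainComplex.augment J.cocomplex (X := T.X₂) (T.g ≫ j)
    (by rw [Category.assoc, w, comp_zero])) T.f ?_ hT.mono_f ?_ ?_ ?_, ?_⟩
  · exact (by rw [← Category.assoc, T.zero, zero_comp] : T.f ≫ (T.g ≫ j) = 0)
  · exact exact_comp_mono_aux T j hT.exact
  · intro n
    cases n with
    | zero => exact exact_epi_comp_aux T.g j _ w hex
    | succ n => exact J.exact_succ n
  · intro n
    cases n with
    | zero => exact hI
    | succ n => exact J.injective n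
  · intro n
    rfl

lemma res_of_hasID [EnoughInjectives C] (M : C) (n : ℕ) (hM : HasInjectiveDimensionLT M (n+1)) :
    ∃ I : InjectiveResolution M, ∀ k, n < k → Limits.IsZero (I.cocomplex.X k) := by
  induction n generalizing M with
  | zero =>
    have : Injective M := injective_iff_hasInjectiveDimensionLT_one.2 hM
    refine ⟨InjectiveResolution.self M, fun k hk => ?_⟩
    exact HomologicalComplex.isZero_single_obj_X _ _ _ _ (by omega)
  | succ n ih =>
    have T_exact := (Classical.choice (EnoughInjectives.presentation M)).shortExact_shortComplex
    have hinj := (Classical.choice (EnoughInjectives.presentation M)).injective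
    obtain ⟨J, hJ⟩ := ih _ ((T_exact.hasInjectiveDimensionLT_X₃_iff n hinj).2 hM)
    obtain ⟨I, hI⟩ := spliceInj _ T_exact hinj J
    refine ⟨I, fun k hk => ?_⟩
    obtain ⟨k, rfl⟩ : ∃ l, k = l+1 := ⟨k-1, by omega⟩
    rw [hI]
    exact hJ _ (by omega)


lemma mkProjRes_aux (M : C) (K : ChainComplex C ℕ) (j : K.X 0 ⟶ M) (w : K.d 1 0 ≫ j = 0)
    [Epi j] (h0 : (ShortComplex.mk (K.d 1 0) j w).Exact)
    (h : ∀ n, (ShortComplex.mk (K.d (n+2) (n+1)) (K.d (n+1) n) (K.d_comp_d _ _ _)).Exact) :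
    QuasiIso ((ChainComplex.toSingle₀Equiv K M).symm ⟨j, w⟩) := ⟨fun n => by
    cases n with
    | zero =>
      rw [ChainComplex.quasiIsoAt₀_iff, ShortComplex.quasiIso_iff_of_zeros']
      · refine (ShortComplex.exact_and_epi_g_iff_of_iso ?_).2 ⟨h0, by dsimp; infer_instance⟩
        refine ShortComplex.isoMk (Iso.refl _) (Iso.refl _) (Iso.refl _) ?_ ?_
        · exact (Category.id_comp _).trans (Category.comp_id _).symm
        · refine (Category.id_comp _).trans ?_
          refine Eq.trans ?_ (Category.comp_id _).symm
          exact (ChainComplex.toSingle₀Equiv_symm_apply_f_zero (C := K) j w).symm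
      · exact K.shape 0 0 (by simp)
      · exact (HomologicalComplex.isZero_single_obj_X (ComplexShape.down ℕ) 0 M 1
          (by simp)).eq_of_src _ _
      · exact ((ChainComplex.single₀ C).obj M).shape 0 0 (by simp)
    | succ n =>
      rw [quasiIsoAt_iff_exactAt']
      · rw [HomologicalComplex.exactAt_iff' _ (n+1+1) (n + 1) n (by simp) (by simp)]
        exact h n
      · apply ChainComplex.exactAt_succ_single_obj⟩

/-- build a projective resolution -/
noncomputable def mkProjRes (M : C) (K : ChainComplex C ℕ) (j : K.X 0 ⟶ M) (w : K.d 1 0 ≫ j = 0)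
    (hj : Epi j) (h0 : (ShortComplex.mk (K.d 1 0) j w).Exact)
    (h : ∀ n, (ShortComplex.mk (K.d (n+2) (n+1)) (K.d (n+1) n) (K.d_comp_d _ _ _)).Exact)
    (hK : ∀ n, Projective (K.X n)) : ProjectiveResolution M where
  complex := K
  projective := hK
  π := (ChainComplex.toSingle₀Equiv K M).symm ⟨j, w⟩
  quasiIso := mkProjRes_aux M K j w h0 h

lemma projRes_data {Z : C} (J : ProjectiveResolution Z) :
    ∃ (j : J.complex.X 0 ⟶ Z) (w : J.complex.d 1 0 ≫ j = 0)
    , Epi j ∧ (ShortComplex.mk (J.complex.d 1 0) j w).Exact := by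
  refine ⟨J.π.f 0, J.complex_d_comp_π_f_zero, inferInstanceAs (Epi (J.π.f 0)), ?_⟩
  exact ShortComplex.exact_of_g_is_cokernel _ J.isColimitCokernelCofork

/-- Splicing a projective resolution. -/
lemma spliceProj (T : ShortComplex C) (hT : T.ShortExact) (hI : Projective T.X₂)
    (J : ProjectiveResolution T.X₁) : ∃ (I : ProjectiveResolution T.X₃),
      ∀ n, I.complex.X (n+1) = J.complex.X n := by
  obtain ⟨j, w, hj, hex⟩ := projRes_data J
  have := hT.mono_f
  have := hT.epi_g
  refine ⟨mkProjRes T.X₃ (ChainComplex.augment J.complex (X := T.X₂) (j ≫ T.f)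
    (by rw [← Category.assoc, w, zero_comp])) T.g ?_ hT.epi_g ?_ ?_ ?_, ?_⟩
  · exact (by rw [Category.assoc, T.zero, comp_zero] : (j ≫ T.f) ≫ T.g = 0)
  · exact exact_epi_comp_aux j T.f T.g T.zero hT.exact
  · intro n
    cases n with
    | zero => exact exact_comp_mono_aux (ShortComplex.mk (J.complex.d 1 0) j w) T.f hex
    | succ n => exact J.exact_succ n
  · intro n
    cases n with
    | zero => exact hI
    | succ n => exact J.projective n
  · intro n
    rfl

lemma res_of_hasPD [EnoughProjectives C] (M : C) (n : ℕ) (hM : HasProjectiveDimensionLT M (n+1)) :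
    ∃ I : ProjectiveResolution M, ∀ k, n < k → Limits.IsZero (I.complex.X k) := by
  induction n generalizing M with
  | zero =>
    have : Projective M := projective_iff_hasProjectiveDimensionLT_one.2 hM
    refine ⟨ProjectiveResolution.self M, fun k hk => ?_⟩
    exact HomologicalComplex.isZero_single_obj_X _ _ _ _ (by omega)
  | succ n ih =>
    have T_exact : (ShortComplex.mk (kernel.ι (Projective.π M)) (Projective.π M)
      (kernel.condition _)).ShortExact := { exact := ShortComplex.exact_kernel _ }
    have hinj : Projective (Projective.over M) := inferInstance
    obtain ⟨J, hJ⟩ := ih _ ((T_exact.hasProjectiveDimensionLT_X₃_iff n hinj).1 hM)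
    obtain ⟨I, hI⟩ := spliceProj _ T_exact hinj J
    refine ⟨I, fun k hk => ?_⟩
    obtain ⟨k, rfl⟩ : ∃ l, k = l+1 := ⟨k-1, by omega⟩
    rw [hI]
    exact hJ _ (by omega)

variable [HasExt.{v} C]

lemma hasID_of_res {M : C} (I : InjectiveResolution M) (n : ℕ)
   (h : ∀ k, n < k → Limits.IsZero (I.cocomplex.X k)) : HasInjectiveDimensionLT M (n+1) := by
  refine HasInjectiveDimensionLT.mk fun i hi Y e => ?_
  obtain ⟨f, hf, rfl⟩ := I.extMk_surjective e (i+1) rfl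
  obtain rfl : f = 0 := (h i hi).eq_of_tgt _ _
  simp


lemma hasPD_of_res {M : C} (I : ProjectiveResolution M) (n : ℕ)
   (h : ∀ k, n < k → Limits.IsZero (I.complex.X k)) : HasProjectiveDimensionLT M (n+1) := by
  refine HasProjectiveDimensionLT.mk fun i hi Y e => ?_
  obtain ⟨f, hf, rfl⟩ := I.extMk_surjective e (i+1) rfl
  obtain rfl : f = 0 := (h i hi).eq_of_src _ _
  simp

end P0

lemma hasInjDimLE_iff (A : Type) [Ring A] (M : ModuleCat A) (n : ℕ) :
    hasInjDimLE A M n ↔ HasInjectiveDimensionLT M (n+1) :=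
  ⟨fun ⟨I, h⟩ => hasID_of_res I n h, fun h => res_of_hasID M n h⟩

lemma hasProjDimLE_iff (A : Type) [Ring A] (M : ModuleCat A) (n : ℕ) :
    hasProjDimLE A M n ↔ HasProjectiveDimensionLT M (n+1) :=
  ⟨fun ⟨I, h⟩ => hasPD_of_res I n h, fun h => res_of_hasPD M n h⟩

lemma ext_subsingleton_of_extGroup_s4 (A : Type) [Ring A] (n : ℕ) (M N : ModuleCat A)
    (h : ¬ Nontrivial (extGroup A n M N)) : Subsingleton (Abelian.Ext M N n) := by
  rw [not_nontrivial_iff_subsingleton] at h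
  let P := projectiveResolution M
  have e := P.isoExt (R := ℤ) n N
  have hz : IsZero ((P.complex.linearYonedaObj ℤ N).homology n) :=
    IsZero.of_iso (ModuleCat.isZero_of_subsingleton (extGroup A n M N)) e.symm
  rw [← HomologicalComplex.exactAt_iff_isZero_homology] at hz
  refine subsingleton_of_forall_eq 0 fun α => ?_
  obtain ⟨f, hf, rfl⟩ := P.extMk_surjective α (n+1) rfl
  cases n with
  | zero =>
    rw [HomologicalComplex.exactAt_iff' _ 0 0 1 (by simp) (by simp)] at hz
    rw [ShortComplex.moduleCat_exact_iff] at hz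
    obtain ⟨g, hg⟩ := hz f hf
    have : f = 0 := by
      rw [← hg]
      have : ((P.complex.linearYonedaObj ℤ N).sc' 0 0 1).f = 0 :=
        (P.complex.linearYonedaObj ℤ N).shape 0 0 (by simp)
      rw [this]; rfl
    subst this
    simp
  | succ n =>
    rw [HomologicalComplex.exactAt_iff' _ n (n+1) (n+1+1) (by simp) (by simp)] at hz
    rw [ShortComplex.moduleCat_exact_iff] at hz
    obtain ⟨g, hg⟩ := hz f hf
    rw [P.extMk_eq_zero_iff _ _ _ _ n rfl]
    exact ⟨g, hg⟩

lemma ext_of_moduleDepth (S : Type) [CommRing S] [IsLocalRing S] (X : ModuleCat S) (d : ℕ)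
    (h : moduleDepth S X = d) (i : ℕ) (hi : i < d) :
    Subsingleton (Abelian.Ext (ModuleCat.of S (S ⧸ IsLocalRing.maximalIdeal S)) X i) := by
  apply ext_subsingleton_of_extGroup_s4
  intro hn
  have : moduleDepth S X ≤ i := sInf_le ⟨i, rfl, hn⟩
  rw [h] at this
  exact absurd (Nat.cast_le.1 this) (by omega)

end Part0

section Part1

open CategoryTheory Abelian Limits

section P1
variable (S A : Type) [CommRing S] [Ring A] [Algebra S A]

/-- the `S`-linear structure on `A`-modules -/
@[reducible] noncomputable def linS : Linear S (ModuleCat.{0} A) :=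
  letI (M : ModuleCat.{0} A) : Module S M := Module.restrictScalars S A M
  haveI (M : ModuleCat.{0} A) : IsScalarTower S A M := IsScalarTower.restrictScalars S A M
  { homModule := fun _ _ => inferInstance }

lemma finite_ext_alg [IsNoetherianRing S] [Module.Finite S A] (N M : ModuleCat.{0} A)
    [Module.Finite A N] [Module.Finite A M] (i : ℕ) :
    letI := linS S A
    Module.Finite S (Ext N M i) := by
  letI := linS S A
  have : IsNoetherianRing A := isNoetherian_of_isNoetherianRing_of_finite S A |> fun _ => 
    isNoetherian_of_tower S inferInstance
  induction i generalizing N with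
  | zero =>
    letI (M : ModuleCat.{0} A) : Module S M := Module.restrictScalars S A M
    haveI (M : ModuleCat.{0} A) : IsScalarTower S A M := IsScalarTower.restrictScalars S A M
    have : Module.Finite S N := Module.Finite.trans A N
    have : Module.Finite S M := Module.Finite.trans A M
    have h1 : Module.Finite S (N →ₗ[A] M) := by
      refine Module.Finite.of_injective (LinearMap.restrictScalarsₗ S A N M S) ?_
      exact LinearMap.restrictScalars_injective S
    exact Module.Finite.equiv (Ext.linearEquiv₀.trans ModuleCat.homLinearEquiv).symm
  | succ n ih =>
    obtain ⟨m, f, surjf⟩ := Module.Finite.exists_fin' A N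
    let exac := LinearMap.shortExact_shortComplexKer surjf
    have : Module.Finite A f.shortComplexKer.X₁ := inferInstanceAs (Module.Finite A (LinearMap.ker f))
    have := ih f.shortComplexKer.X₁
    have : Projective f.shortComplexKer.X₂ :=
      
      (IsProjective.iff_projective (Fin m → A)).1 inferInstance
    exact Module.Finite.of_surjective (exac.extClass.precompOfLinear S M (add_comm 1 n))
      (precomp_extClass_surjective_of_projective_X₂ M exac n)

/-- multiplication by a central element -/
@[reducible] def cmul (Z : Type) [AddCommGroup Z] [Module A Z] (x : S) : Z →ₗ[A] Z where
  toFun z := algebraMap S A x • z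
  map_add' := smul_add _
  map_smul' a z := by
    simp only [RingHom.id_apply, ← mul_smul, Algebra.commutes]

lemma nakayama_ext [IsNoetherianRing S] [IsLocalRing S] [Module.Finite S A]
    (Z W : Type) [AddCommGroup Z] [Module A Z] [AddCommGroup W] [Module A W]
    [Module.Finite A Z] [Module.Finite A W] (x : S) (hx : x ∈ IsLocalRing.maximalIdeal S)
    (hreg : Function.Injective (cmul S A Z x)) (j : ℕ)
    (h : Subsingleton (Ext (ModuleCat.of A (Z ⧸ LinearMap.range (cmul S A Z x)))
      (ModuleCat.of A W) (j+1))) :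
    Subsingleton (Ext (ModuleCat.of A Z) (ModuleCat.of A W) j) := by
  letI := linS S A
  have hfin := finite_ext_alg S A (ModuleCat.of A Z) (ModuleCat.of A W) j
  let T : ShortComplex (ModuleCat.{0} A) :=
    ShortComplex.mk (ModuleCat.ofHom (cmul S A Z x))
      (ModuleCat.ofHom (LinearMap.range (cmul S A Z x)).mkQ)
      (by ext z; exact (Submodule.Quotient.mk_eq_zero _).2 ⟨z, rfl⟩)
  have hT : T.ShortExact := {
    exact := by
      rw [ShortComplex.ShortExact.moduleCat_exact_iff_function_exact]
      exact LinearMap.exact_map_mkQ_range _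
    mono_f := (ModuleCat.mono_iff_injective _).2 hreg
    epi_g := (ModuleCat.epi_iff_surjective _).2 (Submodule.mkQ_surjective _) }
  have hf : T.f = x • 𝟙 (ModuleCat.of A Z) := by
    ext z; rfl
  have hsub : (⊤ : Submodule S (Ext (ModuleCat.of A Z) (ModuleCat.of A W) j)) ≤
      IsLocalRing.maximalIdeal S • ⊤ := by
    intro e _
    obtain ⟨e', he'⟩ := Ext.contravariant_sequence_exact₁ hT (ModuleCat.of A W) e (add_comm 1 j)
      (Subsingleton.elim (α := Ext (ModuleCat.of A (Z ⧸ LinearMap.range (cmul S A Z x)))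
      (ModuleCat.of A W) (j+1)) _ _)
    rw [hf, Ext.mk₀_smul, Ext.smul_comp, Ext.mk₀_id_comp] at he'
    rw [← he']
    exact Submodule.smul_mem_smul hx trivial
  have := Submodule.eq_bot_of_le_smul_of_le_jacobson_bot _ _ hfin.fg_top hsub
    (IsLocalRing.maximalIdeal_le_jacobson _)
  exact (Submodule.subsingleton_iff S).1 (subsingleton_of_bot_eq_top this.symm)

open RingTheory.Sequence

lemma ext_vanish [IsNoetherianRing S] [IsLocalRing S] [Module.Finite S A]
    (W : Type) [AddCommGroup W] [Module A W] [Module.Finite A W] (n : ℕ)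
    (hW : HasInjectiveDimensionLT (ModuleCat.of A W) n) 
    (rs : List S) (hrs : ∀ r ∈ rs, r ∈ IsLocalRing.maximalIdeal S)
    (Z : Type) [AddCommGroup Z] [Module A Z] [Module.Finite A Z] [Module S Z] [IsScalarTower S A Z]
    (hZ : IsWeaklyRegular Z rs) (j : ℕ) (hj : n ≤ j + rs.length) :
    Subsingleton (Ext (ModuleCat.of A Z) (ModuleCat.of A W) j) := by
  induction rs generalizing Z j with
  | nil => exact HasInjectiveDimensionLT.subsingleton _ n j (by simpa using hj) _
  | cons x rs ih =>
    rw [isWeaklyRegular_cons_iff] at hZ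
    refine nakayama_ext S A Z W x (hrs x (by simp)) ?_ j ?_
    · intro a b hab
      refine hZ.1 ?_
      simpa using hab
    · refine ih (fun r hr => hrs r (by simp [hr])) _ ?_ _ (by simp at hj; omega)
      refine (LinearEquiv.isWeaklyRegular_congr ?_ rs).1 hZ.2
      refine Submodule.quotEquivOfEq _ ((LinearMap.range (cmul S A Z x)).restrictScalars S) ?_
        ≪≫ₗ (Submodule.Quotient.restrictScalarsEquiv S (LinearMap.range (cmul S A Z x)))
      ext z
      simp [Submodule.mem_smul_pointwise_iff_exists]
end P1

end Part1

section Part2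

open CategoryTheory Abelian Limits

section P2a
universe w v u
variable {C : Type u} [Category.{v} C] [Abelian C] [HasExt.{w} C]

lemma sub_of_zero {G : Type*} [AddGroup G] (h : ∀ x : G, x = 0) : Subsingleton G :=
  ⟨fun a b => (h a).trans (h b).symm⟩

lemma exs_X₂ {T : ShortComplex C} (hT : T.ShortExact) (Y : C) (n : ℕ)
    (h1 : Subsingleton (Abelian.Ext T.X₁ Y n)) (h3 : Subsingleton (Abelian.Ext T.X₃ Y n)) :
    Subsingleton (Abelian.Ext T.X₂ Y n) := by
  refine sub_of_zero fun x => ?_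
  obtain ⟨y, rfl⟩ := Ext.contravariant_sequence_exact₂ hT Y x (Subsingleton.elim _ _)
  rw [Subsingleton.elim y 0, Ext.comp_zero]

lemma exs_X₁ {T : ShortComplex C} (hT : T.ShortExact) (Y : C) (n : ℕ)
    (h2 : Subsingleton (Abelian.Ext T.X₂ Y n)) (h3 : Subsingleton (Abelian.Ext T.X₃ Y (n+1))) :
    Subsingleton (Abelian.Ext T.X₁ Y n) := by
  refine sub_of_zero fun x => ?_
  obtain ⟨y, rfl⟩ := Ext.contravariant_sequence_exact₁ hT Y x (add_comm 1 n) (Subsingleton.elim _ _)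
  rw [Subsingleton.elim y 0, Ext.comp_zero]

lemma exs_X₃ {T : ShortComplex C} (hT : T.ShortExact) (Y : C) (n : ℕ)
    (h1 : Subsingleton (Abelian.Ext T.X₁ Y n)) (h2 : Subsingleton (Abelian.Ext T.X₂ Y (n+1))) :
    Subsingleton (Abelian.Ext T.X₃ Y (n+1)) := by
  refine sub_of_zero fun x => ?_
  obtain ⟨y, rfl⟩ := Ext.contravariant_sequence_exact₃ hT Y x (Subsingleton.elim _ _) (add_comm 1 n)
  rw [Subsingleton.elim y 0, Ext.comp_zero]

lemma cos_X₃ {T : ShortComplex C} (hT : T.ShortExact) (Z : C) (n : ℕ)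
    (h2 : Subsingleton (Abelian.Ext Z T.X₂ n)) (h1 : Subsingleton (Abelian.Ext Z T.X₁ (n+1))) :
    Subsingleton (Abelian.Ext Z T.X₃ n) := by
  refine sub_of_zero fun x => ?_
  obtain ⟨y, rfl⟩ := Ext.covariant_sequence_exact₃ Z hT x rfl (Subsingleton.elim _ _)
  rw [Subsingleton.elim y 0, Ext.zero_comp]

lemma ext_extend {T : ShortComplex C} (hT : T.ShortExact) (Y : C)
    (h3 : Subsingleton (Abelian.Ext T.X₃ Y 1)) (u : T.X₁ ⟶ Y) : ∃ v : T.X₂ ⟶ Y, T.f ≫ v = u := by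
  obtain ⟨y, hy⟩ := Ext.contravariant_sequence_exact₁ hT Y (Ext.mk₀ u) (add_zero 1)
    (Subsingleton.elim _ _)
  obtain ⟨v, rfl⟩ := Ext.addEquiv₀.symm.surjective y
  refine ⟨v, ?_⟩
  apply Ext.addEquiv₀.symm.injective
  simpa using hy

lemma ext_lift {T : ShortComplex C} (hT : T.ShortExact) (Z : C)
    (h3 : Subsingleton (Abelian.Ext Z T.X₁ 1)) (u : Z ⟶ T.X₃) : ∃ v : Z ⟶ T.X₂, v ≫ T.g = u := by
  obtain ⟨y, hy⟩ := Ext.covariant_sequence_exact₃ Z hT (Ext.mk₀ u) (zero_add 1)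
    (Subsingleton.elim _ _)
  obtain ⟨v, rfl⟩ := Ext.addEquiv₀.symm.surjective y
  refine ⟨v, ?_⟩
  apply Ext.addEquiv₀.symm.injective
  simpa using hy

lemma exs_iso {X X' : C} (e : X ≅ X') (Y : C) (n : ℕ) (h : Subsingleton (Abelian.Ext X Y n)) :
    Subsingleton (Abelian.Ext X' Y n) := by
  refine sub_of_zero fun x => ?_
  have : x = (Ext.mk₀ e.inv).comp ((Ext.mk₀ e.hom).comp x (zero_add n)) (zero_add n) := by simp
  rw [this, Subsingleton.elim ((Ext.mk₀ e.hom).comp x (zero_add n)) 0, Ext.comp_zero]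
end P2a

section P2b
variable {A : Type} [Ring A]

lemma mk_ses {M N P : Type} [AddCommGroup M] [AddCommGroup N] [AddCommGroup P] [Module A M]
    [Module A N] [Module A P] (f : M →ₗ[A] N) (g : N →ₗ[A] P) (hf : Function.Injective f)
    (hg : Function.Surjective g) (hfg : Function.Exact f g) :
    (ModuleCat.shortComplexOfCompEqZero f g hfg.linearMap_comp_eq_zero).ShortExact :=
  ModuleCat.shortComplex_shortExact _ hfg hf hg

lemma ext_proj_sub (P : Type) [AddCommGroup P] [Module A P] [Module.Projective A P]
    (Y : ModuleCat.{0} A) (n : ℕ) : Subsingleton (Abelian.Ext (ModuleCat.of A P) Y (n+1)) := by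
  have : Projective (ModuleCat.of A P) := (IsProjective.iff_projective P).1 inferInstance
  exact sub_of_zero fun x => Ext.eq_zero_of_projective x

lemma hom_sub_iff (M N : Type) [AddCommGroup M] [AddCommGroup N] [Module A M]
    [Module A N] : Subsingleton (Abelian.Ext (ModuleCat.of A M) (ModuleCat.of A N) 0) ↔
      Subsingleton (M →ₗ[A] N) :=
  (Ext.addEquiv₀.trans ModuleCat.homAddEquiv).subsingleton_congr

lemma sub_of_ext_self (M : ModuleCat.{0} A)
    (h : Subsingleton (Abelian.Ext (ModuleCat.of A A) M 0)) : Subsingleton M := by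
  have h : Subsingleton (A →ₗ[A] M) := (hom_sub_iff A M).1 h
  exact (LinearMap.ringLmapEquivSelf A ℤ M).symm.subsingleton

/-- injective dimension is tested on finitely generated modules -/
lemma id_of_fg (M : ModuleCat.{0} A) (e : ℕ)
    (h : ∀ (N : Type) [AddCommGroup N] [Module A N] [Module.Finite A N],
      Subsingleton (Abelian.Ext (ModuleCat.of A N) M e)) : HasInjectiveDimensionLT M e := by
  match e with
  | 0 =>
    have := sub_of_ext_self M (h A)
    exact (ModuleCat.isZero_of_subsingleton M).hasInjectiveDimensionLT_zero
  | e + 1 =>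
    induction e generalizing M with
    | zero =>
      refine injective_iff_hasInjectiveDimensionLT_one.1 ?_
      rw [← Module.injective_iff_injective_object A M, ← Module.Baer.iff_injective]
      intro I g
      have hs := mk_ses I.subtype I.mkQ I.injective_subtype I.mkQ_surjective
        (LinearMap.exact_subtype_mkQ I)
      obtain ⟨v, hv⟩ := ext_extend hs M (h (A ⧸ I)) (ModuleCat.ofHom g)
      refine ⟨v.hom, fun x hx => ?_⟩
      exact congrArg (fun k => k.hom ⟨x, hx⟩) hv
    | succ e ih =>
      let ⟨I, _, f, _⟩ := EnoughInjectives.presentation M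
      have injf : Function.Injective f.hom := (ModuleCat.mono_iff_injective f).mp ‹_›
      have hs := mk_ses f.hom f.hom.range.mkQ injf (Submodule.mkQ_surjective _)
        f.hom.exact_map_mkQ_range
      refine (hs.hasInjectiveDimensionLT_X₃_iff e ‹_›).1 (ih _ fun N _ _ _ => ?_)
      exact cos_X₃ hs _ _ (sub_of_zero fun x => Ext.eq_zero_of_injective x) (h N)
end P2b

end Part2

section Part3

open CategoryTheory Abelian Limits
open RingTheory.Sequence IsLocalRing

section P3
variable (S : Type) [CommRing S] [IsNoetherianRing S] [IsLocalRing S]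

lemma bass_a (e : ℕ) (he : HasInjectiveDimensionLT (ModuleCat.of S S) (e+1))
    (hk : Subsingleton (Abelian.Ext (ModuleCat.of S (S ⧸ maximalIdeal S)) (ModuleCat.of S S) e)) :
    HasInjectiveDimensionLT (ModuleCat.of S S) e := by
  refine id_of_fg _ _ fun N _ _ hN => ?_
  induction hN using
    IsNoetherianRing.induction_on_isQuotientEquivQuotientPrime S with
  | subsingleton N =>
    refine sub_of_zero fun x => ?_
    have : HasProjectiveDimensionLT (ModuleCat.of S N) 0 := 
      (ModuleCat.isZero_of_subsingleton (ModuleCat.of S N)).hasProjectiveDimensionLT_zero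
    exact Ext.eq_zero_of_hasProjectiveDimensionLT x 0 (Nat.zero_le _)
  | quotient N p f =>
    refine exs_iso f.symm.toModuleIso _ _ ?_
    by_cases hp : p.1 = maximalIdeal S
    · rw [hp]; exact hk
    · have hlt : ¬ maximalIdeal S ≤ p.1 := fun h => hp (le_antisymm (le_maximalIdeal p.2.ne_top) h)
      obtain ⟨x, hx, hxp⟩ := SetLike.not_le_iff_exists.1 hlt
      refine nakayama_ext S S _ _ x hx ?_ e
        (HasInjectiveDimensionLT.subsingleton _ (e+1) (e+1) le_rfl _)
      rw [injective_iff_map_eq_zero]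
      intro z hz
      obtain ⟨z, rfl⟩ := Ideal.Quotient.mk_surjective z
      have hz : Ideal.Quotient.mk p.1 (x * z) = 0 := hz
      rw [Ideal.Quotient.eq_zero_iff_mem] at hz ⊢
      exact (p.2.mem_or_mem hz).resolve_left hxp
  | exact N₁ N₂ N₃ f g hf hg hfg h₁ h₃ =>
    exact exs_X₂ (mk_ses f g hf hg hfg) _ _ h₁ h₃

lemma bass_b (e : ℕ) (he : HasInjectiveDimensionLT (ModuleCat.of S S) (e+1))
    (hk : ¬ Subsingleton (Abelian.Ext (ModuleCat.of S (S ⧸ maximalIdeal S)) (ModuleCat.of S S) e))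
    (t : ℕ) (ht : t ≤ e) : ∃ rs : List S, (∀ r ∈ rs, r ∈ maximalIdeal S) ∧
      IsWeaklyRegular S rs ∧ rs.length = t := by
  induction t with
  | zero => exact ⟨[], by simp⟩
  | succ t ih =>
    obtain ⟨rs, h1, h2, h3⟩ := ih (by omega)
    let N := S ⧸ (Ideal.ofList rs • (⊤ : Submodule S S))
    have hpd := ModuleCat.projectiveDimension_quotient_eq_add_length_of_isWeaklyRegular
      (ModuleCat.of S S) rs h2 h1
    have hp0 : projectiveDimension (ModuleCat.of S S) ≤ 0 := by
      have : Projective (ModuleCat.of S S) := (IsProjective.iff_projective S).1 inferInstance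
      exact (projectiveDimension_le_iff _ 0).2 inferInstance
    have hle : projectiveDimension (ModuleCat.of S N) ≤ (t : ℕ) := by
      change projectiveDimension (ModuleCat.of S N) = _ at hpd
      rw [hpd, h3]
      calc _ ≤ 0 + ((t : ℕ) : WithBot ℕ∞) := by gcongr
        _ = _ := by simp
    have hpd2 : HasProjectiveDimensionLT (ModuleCat.of S N) (t+1) :=
      (projectiveDimension_le_iff _ t).1 hle
    have hN : Subsingleton (Abelian.Ext (ModuleCat.of S N) (ModuleCat.of S S) e) := 
      HasProjectiveDimensionLT.subsingleton _ (t+1) e ht _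
    have hsub : Subsingleton ((S ⧸ maximalIdeal S) →ₗ[S] N) := by
      by_contra hns
      rw [not_subsingleton_iff_nontrivial] at hns
      obtain ⟨f, hf⟩ := exists_ne (0 : (S ⧸ maximalIdeal S) →ₗ[S] N)
      have : IsSimpleModule S (S ⧸ maximalIdeal S) :=
        isSimpleModule_iff_isCoatom.2 (maximalIdeal.isMaximal S).out
      have hinj : Function.Injective f := (LinearMap.injective_or_eq_zero f).resolve_right hf
      exact hk (exs_X₁ (mk_ses f f.range.mkQ hinj (Submodule.mkQ_surjective _)
        f.exact_map_mkQ_range) _ _ hN (HasInjectiveDimensionLT.subsingleton _ (e+1) (e+1) le_rfl _))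
    obtain ⟨r, hr, hreg⟩ := IsSMulRegular.subsingleton_linearMap_iff.1 hsub
    rw [Ideal.annihilator_quotient] at hr
    refine ⟨rs ++ [r], ?_, ?_, by simp [h3]⟩
    · intro s hs
      rcases List.mem_append.1 hs with hs | hs
      · exact h1 s hs
      · rw [List.mem_singleton.1 hs]; exact hr
    · rw [isWeaklyRegular_append_iff]
      refine ⟨h2, ?_⟩
      rw [isWeaklyRegular_cons_iff]
      exact ⟨hreg, IsWeaklyRegular.nil _ _⟩

/-- Bass: the injective dimension is at most the length of a regular sequence -/
lemma bass (m : ℕ) (he : HasInjectiveDimensionLT (ModuleCat.of S S) m) :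
    ∃ rs : List S, (∀ r ∈ rs, r ∈ maximalIdeal S) ∧ IsWeaklyRegular S rs ∧
      HasInjectiveDimensionLT (ModuleCat.of S S) (rs.length + 1) := by
  induction m with
  | zero =>
    have := isZero_of_hasInjectiveDimensionLT_zero (ModuleCat.of S S)
    have := ModuleCat.subsingleton_of_isZero this
    exact absurd this (not_subsingleton S)
  | succ e ih =>
    by_cases hk : Subsingleton (Abelian.Ext (ModuleCat.of S (S ⧸ maximalIdeal S)) (ModuleCat.of S S) e)
    · exact ih (bass_a S e he hk)
    · obtain ⟨rs, h1, h2, h3⟩ := bass_b S e he hk e le_rfl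
      exact ⟨rs, h1, h2, h3 ▸ he⟩

lemma reg_len_le (rs : List S) (h1 : ∀ r ∈ rs, r ∈ maximalIdeal S) (h2 : IsWeaklyRegular S rs)
    (d : ℕ) (hd : ringKrullDim S = d) : rs.length ≤ d := by
  have hreg : IsRegular S rs := (isRegular_iff_isWeaklyRegular_of_subset_maximalIdeal h1).2 h2
  have h := ringKrullDim_add_length_eq_ringKrullDim_of_isRegular rs hreg
  rw [hd] at h
  have hne : Nontrivial (S ⧸ Ideal.ofList rs) := by
    refine Ideal.Quotient.nontrivial_iff.2 ?_
    have := hreg.2.symm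
    simpa using this
  have h0 : 0 ≤ ringKrullDim (S ⧸ Ideal.ofList rs) := ringKrullDim_nonneg_of_nontrivial
  have : ((rs.length : ℕ) : WithBot ℕ∞) ≤ (d : ℕ) := by
    rw [← h]
    calc _ = 0 + ((rs.length : ℕ) : WithBot ℕ∞) := by simp
      _ ≤ _ := by gcongr
  exact_mod_cast this

lemma reg_of_depth (M : Type) [AddCommGroup M] [Module S M] [Module.Finite S M] [Nontrivial M]
    (d : ℕ) (h : moduleDepth S (ModuleCat.of S M) = d) :
    ∃ rs : List S, (∀ r ∈ rs, r ∈ maximalIdeal S) ∧ IsWeaklyRegular M rs ∧ rs.length = d := by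
  obtain ⟨rs, h1, h2, h3⟩ := ModuleCat.exists_isRegular_of_exists_subsingleton_ext (maximalIdeal S) d
    (ModuleCat.of S M)
    (lt_top_iff_ne_top.2 (Submodule.top_ne_ideal_smul_of_le_jacobson_annihilator
      (maximalIdeal_le_jacobson _)).symm)
    (ModuleCat.of S (S ⧸ maximalIdeal S)) (by
      rw [Module.support_eq_zeroLocus, Ideal.annihilator_quotient])
    (fun i hi => ext_of_moduleDepth S _ d h i hi)
  exact ⟨rs, h2, h3.1, h1⟩

end P3

end Part3

section Part4

open CategoryTheory Abelian Limits
open RingTheory.Sequence IsLocalRing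

section P4
variable (S : Type) [CommRing S]

/-- modules with no higher Ext into the ring -/
def Acyc (M : Type) [AddCommGroup M] [Module S M] : Prop :=
  ∀ i : ℕ, Subsingleton (Abelian.Ext (ModuleCat.of S M) (ModuleCat.of S S) (i+1))

variable {S}
variable {K F M : Type} [AddCommGroup K] [Module S K] [AddCommGroup F] [Module S F]
  [AddCommGroup M] [Module S M]

lemma acyc_proj (P : Type) [AddCommGroup P] [Module S P] [Module.Projective S P] : Acyc S P :=
  fun i => ext_proj_sub P _ i

lemma acyc_ker {f : K →ₗ[S] F} {g : F →ₗ[S] M} (hf : Function.Injective f)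
    (hg : Function.Surjective g) (hfg : Function.Exact f g) (hF : Acyc S F) (hM : Acyc S M) :
    Acyc S K := fun i => exs_X₁ (mk_ses f g hf hg hfg) _ _ (hF i) (hM (i+1))

/-- transpose -/
abbrev dl (f : K →ₗ[S] F) : (F →ₗ[S] S) →ₗ[S] (K →ₗ[S] S) := LinearMap.lcomp S S f

lemma dl_inj {g : F →ₗ[S] M} (hg : Function.Surjective g) : Function.Injective (dl g) :=
  LinearMap.lcomp_injective_of_surjective g hg

lemma dl_exact {f : K →ₗ[S] F} {g : F →ₗ[S] M} (hg : Function.Surjective g)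
    (hfg : Function.Exact f g) : Function.Exact (dl g) (dl f) :=
  LinearMap.exact_lcomp_of_exact_of_surjective _ hfg hg

lemma dl_surj {f : K →ₗ[S] F} {g : F →ₗ[S] M} (hf : Function.Injective f)
    (hg : Function.Surjective g) (hfg : Function.Exact f g) (hM : Acyc S M) :
    Function.Surjective (dl f) := by
  intro u
  obtain ⟨v, hv⟩ := ext_extend (mk_ses f g hf hg hfg) (ModuleCat.of S S) (hM 0) (ModuleCat.ofHom u)
  refine ⟨v.hom, ?_⟩
  ext x
  exact congrArg (fun k => k.hom x) hv

lemma exists_pres [IsNoetherianRing S] (M : Type) [AddCommGroup M] [Module S M]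
    [Module.Finite S M] : ∃ (n : ℕ) (K : Type) (_ : AddCommGroup K) (_ : Module S K)
      (_ : Module.Finite S K) (f : K →ₗ[S] (Fin n → S)) (g : (Fin n → S) →ₗ[S] M),
      Function.Injective f ∧ Function.Surjective g ∧ Function.Exact f g := by
  obtain ⟨m, f, surjf⟩ := Module.Finite.exists_fin' S M
  exact ⟨m, LinearMap.ker f, inferInstance, inferInstance, inferInstance, (LinearMap.ker f).subtype,
    f, Submodule.injective_subtype _, surjf, LinearMap.exact_subtype_ker_map f⟩

lemma acyc_dual [IsNoetherianRing S] (n : ℕ) (hS : HasInjectiveDimensionLT (ModuleCat.of S S) n)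
    (M : Type) [AddCommGroup M] [Module S M] [Module.Finite S M] (hM : Acyc S M) :
    Acyc S (M →ₗ[S] S) := by
  suffices h : ∀ (j : ℕ) (M : Type) [AddCommGroup M] [Module S M] [Module.Finite S M],
      Acyc S M → ∀ i : ℕ, n ≤ i + 1 + j →
      Subsingleton (Abelian.Ext (ModuleCat.of S (M →ₗ[S] S)) (ModuleCat.of S S) (i+1)) by
    intro i
    exact h n M hM i (by omega)
  intro j
  induction j with
  | zero => 
    intro M _ _ _ _ i hi
    exact HasInjectiveDimensionLT.subsingleton _ n (i+1) (by simpa using hi) _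
  | succ j ih =>
    intro M _ _ _ hM i hi
    obtain ⟨m, K, _, _, _, f, g, hf, hg, hfg⟩ := exists_pres (S := S) M
    have hK : Acyc S K := acyc_ker hf hg hfg (acyc_proj _) hM
    have := ih K hK (i+1) (by omega)
    exact exs_X₁ (mk_ses (dl g) (dl f) (dl_inj hg) (dl_surj hf hg hfg hM) (dl_exact hg hfg)) _ _
      (ext_proj_sub _ _ i) this

lemma eval_surj [IsNoetherianRing S] (n : ℕ) (hS : HasInjectiveDimensionLT (ModuleCat.of S S) n)
    (M : Type) [AddCommGroup M] [Module S M] [Module.Finite S M] (hM : Acyc S M) :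
    Function.Surjective (Module.Dual.eval S M) := by
  obtain ⟨m, K, _, _, _, f, g, hf, hg, hfg⟩ := exists_pres (S := S) M
  have hK : Acyc S K := acyc_ker hf hg hfg (acyc_proj _) hM
  intro y
  obtain ⟨z, rfl⟩ := dl_surj (dl_inj hg) (dl_surj hf hg hfg hM) (dl_exact hg hfg)
    (acyc_dual n hS K hK) y
  obtain ⟨x, rfl⟩ := (Module.bijective_dual_eval S (Fin m → S)).2 z
  exact ⟨g x, rfl⟩

lemma eval_bij [IsNoetherianRing S] (n : ℕ) (hS : HasInjectiveDimensionLT (ModuleCat.of S S) n)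
    (M : Type) [AddCommGroup M] [Module S M] [Module.Finite S M] (hM : Acyc S M) :
    Function.Bijective (Module.Dual.eval S M) := by
  refine ⟨?_, eval_surj n hS M hM⟩
  obtain ⟨m, K, _, _, _, f, g, hf, hg, hfg⟩ := exists_pres (S := S) M
  have hK : Acyc S K := acyc_ker hf hg hfg (acyc_proj _) hM
  rw [injective_iff_map_eq_zero]
  intro y hy
  obtain ⟨x, rfl⟩ := hg y
  have h1 : dl (dl g) (Module.Dual.eval S (Fin m → S) x) = 0 := hy
  obtain ⟨z, hz⟩ := (dl_exact (dl_surj hf hg hfg hM) (dl_exact hg hfg) _).1 h1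
  obtain ⟨k, rfl⟩ := eval_surj n hS K hK z
  have h2 : Module.Dual.eval S (Fin m → S) (f k) = Module.Dual.eval S (Fin m → S) x := hz
  have h3 := (Module.bijective_dual_eval S (Fin m → S)).1 h2
  exact (hfg x).2 ⟨k, h3⟩

open scoped Pointwise in
lemma wreg_hom (rs : List S) (N : Type) [AddCommGroup N] [Module S N] (hN : IsWeaklyRegular N rs)
    (hKN : ∀ i : ℕ, Subsingleton (Abelian.Ext (ModuleCat.of S K) (ModuleCat.of S N) (i+1))) :
    IsWeaklyRegular (K →ₗ[S] N) rs := by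
  induction rs generalizing N with
  | nil => exact IsWeaklyRegular.nil _ _
  | cons x rs ih =>
    rw [isWeaklyRegular_cons_iff] at hN ⊢
    have hses := IsSMulRegular.smulShortComplex_shortExact (M := ModuleCat.of S N) hN.1
    refine ⟨?_, ?_⟩
    · intro f g hfg
      ext k
      exact hN.1 (congrArg (fun h => h k) hfg)
    · have h1 : ∀ i : ℕ, Subsingleton (Abelian.Ext (ModuleCat.of S K)
          (ModuleCat.of S (QuotSMulTop x N)) (i+1)) := fun i =>
        cos_X₃ hses _ _ (hKN i) (hKN (i+1))
      have h2 := ih (QuotSMulTop x N) hN.2 h1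
      let φ : (K →ₗ[S] N) →ₗ[S] (K →ₗ[S] QuotSMulTop x N) :=
        LinearMap.llcomp S K N (QuotSMulTop x N) (x • (⊤ : Submodule S N)).mkQ
      have hφ : Function.Surjective φ := by
        intro u
        obtain ⟨v, hv⟩ := ext_lift hses (ModuleCat.of S K) (hKN 0) (ModuleCat.ofHom u)
        refine ⟨v.hom, ?_⟩
        ext k
        exact congrArg (fun h => h.hom k) hv
      have hker : LinearMap.ker φ = x • ⊤ := by
        ext u
        rw [LinearMap.mem_ker, Submodule.mem_smul_pointwise_iff_exists]
        constructor
        · intro hu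
          have hk : ∀ k, ∃ y : N, x • y = u k := by
            intro k
            have : (x • (⊤ : Submodule S N)).mkQ (u k) = 0 := congrArg (fun h => h k) hu
            rw [Submodule.mkQ_apply, Submodule.Quotient.mk_eq_zero,
              Submodule.mem_smul_pointwise_iff_exists] at this
            obtain ⟨y, -, hy⟩ := this
            exact ⟨y, hy⟩
          choose v hv using hk
          refine ⟨⟨⟨v, fun a b => hN.1 ?_⟩, fun s a => hN.1 ?_⟩, trivial, ?_⟩
          · simp [hv]
          · simp only [hv, map_smul, RingHom.id_apply]
            rw [smul_comm, hv]
          · ext k; exact hv k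
        · rintro ⟨v, -, rfl⟩
          ext k
          refine (Submodule.Quotient.mk_eq_zero _).2 ?_
          exact Submodule.smul_mem_pointwise_smul _ _ _ trivial
      refine (LinearEquiv.isWeaklyRegular_congr ?_ rs).1 h2
      exact ((Submodule.quotEquivOfEq _ _ hker.symm).trans (φ.quotKerEquivOfSurjective hφ)).symm
end P4

end Part4

section Part5

open CategoryTheory Abelian Limits

section P5
variable {S B : Type} [Ring S] [Ring B] (f : S →+* B)

lemma coext_ses {T : ShortComplex (ModuleCat.{0} S)} (hT : T.ShortExact)
    (h : Subsingleton (Abelian.Ext ((ModuleCat.restrictScalars f).obj (ModuleCat.of B B)) T.X₁ 1))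
    [(ModuleCat.coextendScalars.{0,0,0} f).PreservesZeroMorphisms] :
    (T.map (ModuleCat.coextendScalars.{0,0,0} f)).ShortExact := by
  have adj := ModuleCat.restrictCoextendScalarsAdj.{0} f
  have := adj.isRightAdjoint
  have : PreservesLimitsOfSize.{0,0} (ModuleCat.coextendScalars.{0,0,0} f) :=
    adj.rightAdjoint_preservesLimits
  have := hT.mono_f
  refine { exact := hT.exact.map_of_mono_of_preservesKernel _ inferInstance inferInstance
           mono_f := inferInstanceAs (Mono ((ModuleCat.coextendScalars.{0,0,0} f).map T.f))
           epi_g := ?_ }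
  rw [ModuleCat.epi_iff_surjective]
  intro u
  obtain ⟨v, hv⟩ := ext_lift hT _ h (ModuleCat.ofHom
    (X := (ModuleCat.restrictScalars f).obj (ModuleCat.of B B)) (ModuleCat.CoextendScalars.equiv f _ u))
  refine ⟨(ModuleCat.CoextendScalars.equiv f _).symm v.hom, ?_⟩
  apply ModuleCat.CoextendScalars.ext
  ext x
  exact congrArg (fun k => k.hom x) hv

lemma coext_id (n : ℕ) (N : ModuleCat.{0} S) (hN : HasInjectiveDimensionLT N (n+1))
    (h : ∀ i : ℕ, Subsingleton
      (Abelian.Ext ((ModuleCat.restrictScalars f).obj (ModuleCat.of B B)) N (i+1))) :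
    HasInjectiveDimensionLT ((ModuleCat.coextendScalars.{0,0,0} f).obj N) (n+1) := by
  have adj := ModuleCat.restrictCoextendScalarsAdj.{0} f
  have := adj.isRightAdjoint
  have hz : (ModuleCat.coextendScalars.{0,0,0} f).PreservesZeroMorphisms := inferInstance
  have hinj : ∀ I : ModuleCat.{0} S, Injective I →
      Injective ((ModuleCat.coextendScalars.{0,0,0} f).obj I) := fun I hI =>
    adj.map_injective I hI
  induction n generalizing N with
  | zero =>
    exact injective_iff_hasInjectiveDimensionLT_one.1
      (hinj _ (injective_iff_hasInjectiveDimensionLT_one.2 hN))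
  | succ n ih =>
    let ⟨I, _, g, _⟩ := EnoughInjectives.presentation N
    have injf : Function.Injective g.hom := (ModuleCat.mono_iff_injective g).mp ‹_›
    have hs := mk_ses g.hom g.hom.range.mkQ injf (Submodule.mkQ_surjective _)
      g.hom.exact_map_mkQ_range
    have hs2 := coext_ses f hs (h 0)
    have h1 := (hs.hasInjectiveDimensionLT_X₃_iff n ‹_›).2 hN
    refine (hs2.hasInjectiveDimensionLT_X₃_iff n (hinj _ ‹_›)).1 (ih _ h1 fun i => ?_)
    exact cos_X₃ hs _ _ (sub_of_zero fun x => Ext.eq_zero_of_injective x) (h _)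
end P5

section P5b
variable (S A : Type) [CommRing S] [Ring A] [Algebra S A]

/-- the opposite ring as a module -/
def opRes : A ≃ₗ[S] ((ModuleCat.restrictScalars (algebraMap S Aᵐᵒᵖ)).obj
    (ModuleCat.of Aᵐᵒᵖ Aᵐᵒᵖ)) where
  toFun a := (MulOpposite.op a : Aᵐᵒᵖ)
  invFun a := MulOpposite.unop (show Aᵐᵒᵖ from a)
  map_add' _ _ := rfl
  map_smul' s a := by
    refine (show (MulOpposite.op (s • a) : Aᵐᵒᵖ) = algebraMap S Aᵐᵒᵖ s * MulOpposite.op a from ?_)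
    rw [← Algebra.smul_def]; rfl
  left_inv _ := rfl
  right_inv _ := rfl

/-- coextension is the dual -/
noncomputable def coextDual : ((ModuleCat.coextendScalars.{0,0,0} (algebraMap S Aᵐᵒᵖ)).obj
    (ModuleCat.of S S)) ≃ₗ[Aᵐᵒᵖ] (A →ₗ[S] S) where
  toFun g := (ModuleCat.CoextendScalars.equiv _ _ g).comp (opRes S A).toLinearMap
  invFun g := (ModuleCat.CoextendScalars.equiv _ _).symm (g.comp (opRes S A).symm.toLinearMap)
  map_add' _ _ := rfl
  map_smul' s g := rfl
  left_inv _ := rfl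
  right_inv _ := rfl

lemma dual_alg_id (n : ℕ) (hS : HasInjectiveDimensionLT (ModuleCat.of S S) (n+1))
    (hA : Acyc S A) : HasInjectiveDimensionLT (ModuleCat.of Aᵐᵒᵖ (A →ₗ[S] S)) (n+1) := by
  have := coext_id (algebraMap S Aᵐᵒᵖ) n (ModuleCat.of S S) hS fun i =>
    exs_iso (opRes S A).toModuleIso _ _ (hA i)
  exact hasInjectiveDimensionLT_of_iso (coextDual S A).toModuleIso _
end P5b

end Part5

section Part6

open CategoryTheory Abelian Limits
open RingTheory.Sequence IsLocalRing

section P6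
variable {S A : Type} [CommRing S] [Ring A] [Algebra S A]

lemma tower_dual (Y : Type) [AddCommGroup Y] [Module S Y] [Module A Y] [IsScalarTower S A Y] :
    IsScalarTower S Aᵐᵒᵖ (Y →ₗ[S] S) := by
  refine ⟨fun s a f => ?_⟩
  ext y
  change f ((s • a.unop) • y) = s • f (a.unop • y)
  rw [smul_assoc, map_smul]

lemma fin_dual [IsNoetherianRing S] [Module.Finite S A]
    (Y : Type) [AddCommGroup Y] [Module S Y] [Module A Y] [IsScalarTower S A Y]
    [Module.Finite A Y] : Module.Finite Aᵐᵒᵖ (Y →ₗ[S] S) := by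
  have := tower_dual (S := S) (A := A) Y
  have : Module.Finite S Y := Module.Finite.trans A Y
  exact Module.Finite.of_restrictScalars_finite S Aᵐᵒᵖ (Y →ₗ[S] S)

variable {K F Y : Type} [AddCommGroup K] [Module S K] [Module A K] [IsScalarTower S A K]
  [AddCommGroup F] [Module S F] [Module A F] [IsScalarTower S A F]
  [AddCommGroup Y] [Module S Y] [Module A Y] [IsScalarTower S A Y]

/-- transpose as a map of right modules -/
def dA (g : F →ₗ[A] Y) : (Y →ₗ[S] S) →ₗ[Aᵐᵒᵖ] (F →ₗ[S] S) where
  toFun u := u.comp (g.restrictScalars S)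
  map_add' _ _ := rfl
  map_smul' a u := by
    ext x
    change u (a.unop • g x) = u (g (a.unop • x))
    rw [g.map_smul]

lemma dA_ses {f : K →ₗ[A] F} {g : F →ₗ[A] Y} (hf : Function.Injective f)
    (hg : Function.Surjective g) (hfg : Function.Exact f g) (hY : Acyc S Y) :
    Function.Injective (dA (S := S) g) ∧ Function.Surjective (dA (S := S) f) ∧
      Function.Exact (dA (S := S) g) (dA (S := S) f) :=
  ⟨dl_inj (g := g.restrictScalars S) hg,
   dl_surj (f := f.restrictScalars S) (g := g.restrictScalars S) hf hg hfg hY,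
   dl_exact (f := f.restrictScalars S) (g := g.restrictScalars S) hg hfg⟩

/-- first inclusion -/
def inc1 (A : Type) [Ring A] (m : ℕ) : A →ₗ[A] (Fin (m+1) → A) := LinearMap.single A (fun _ => A) 0
/-- tail projection -/
def tl1 (A : Type) [Ring A] (m : ℕ) : (Fin (m+1) → A) →ₗ[A] (Fin m → A) :=
  LinearMap.funLeft A A Fin.succ

lemma inc1_inj (m : ℕ) : Function.Injective (inc1 A m) := by
  intro a b h
  simpa [inc1] using congrFun h 0

lemma tl1_surj (m : ℕ) : Function.Surjective (tl1 A m) :=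
  LinearMap.funLeft_surjective_of_injective _ _ _ (Fin.succ_injective m)

lemma inc_tl_exact (m : ℕ) : Function.Exact (inc1 A m) (tl1 A m) := by
  intro v
  constructor
  · intro h
    refine ⟨v 0, ?_⟩
    ext i
    refine Fin.cases ?_ (fun j => ?_) i
    · simp [inc1]
    · have := congrFun h j
      simp only [tl1, LinearMap.funLeft_apply, Pi.zero_apply] at this
      simp [inc1, this]
  · rintro ⟨a, rfl⟩
    ext j
    simp [inc1, tl1, LinearMap.funLeft_apply]

lemma acyc_free (hA : Acyc S A) (m : ℕ) : Acyc S (Fin m → A) := by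
  induction m with
  | zero => exact acyc_proj (S := S) (Fin 0 → A)
  | succ m ih =>
    intro i
    exact exs_X₂ (mk_ses ((inc1 A m).restrictScalars S) ((tl1 A m).restrictScalars S)
      (inc1_inj m) (tl1_surj m) (inc_tl_exact m)) _ _ (hA i) (ih i)

lemma id_free (hA : Acyc S A) (d : ℕ)
    (hid : HasInjectiveDimensionLT (ModuleCat.of Aᵐᵒᵖ (A →ₗ[S] S)) (d+1)) (m : ℕ) :
    HasInjectiveDimensionLT (ModuleCat.of Aᵐᵒᵖ ((Fin m → A) →ₗ[S] S)) (d+1) := by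
  induction m with
  | zero =>
    have : HasInjectiveDimensionLT (ModuleCat.of Aᵐᵒᵖ ((Fin 0 → A) →ₗ[S] S)) 0 :=
      (ModuleCat.isZero_of_subsingleton _).hasInjectiveDimensionLT_zero
    exact hasInjectiveDimensionLT_of_ge _ 0 (d+1) (Nat.zero_le _)
  | succ m ih =>
    obtain ⟨h1, h2, h3⟩ := dA_ses (S := S) (inc1_inj (A := A) m) (tl1_surj m) (inc_tl_exact m)
      (acyc_free hA m)
    exact (mk_ses _ _ h1 h2 h3).hasInjectiveDimensionLT_X₂ _ ih hid

lemma fwd [IsNoetherianRing S] [Module.Finite S A] (hA : Acyc S A) (d : ℕ)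
    (hid : HasInjectiveDimensionLT (ModuleCat.of Aᵐᵒᵖ (A →ₗ[S] S)) (d+1)) (n : ℕ)
    (Y : Type) [AddCommGroup Y] [Module S Y] [Module A Y] [IsScalarTower S A Y]
    [Module.Finite A Y] (hY : Acyc S Y) (h : HasProjectiveDimensionLT (ModuleCat.of A Y) (n+1)) :
    HasInjectiveDimensionLT (ModuleCat.of Aᵐᵒᵖ (Y →ₗ[S] S)) (n+d+1) := by
  have : IsNoetherianRing A := isNoetherian_of_tower S inferInstance
  induction n generalizing Y with
  | zero =>
    obtain ⟨m, g, hg⟩ := Module.Finite.exists_fin' A Y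
    have h1 : Projective (ModuleCat.of A Y) :=
      projective_iff_hasProjectiveDimensionLT_one.2 h
    have h2 : Module.Projective A Y := (IsProjective.iff_projective Y).2 h1
    obtain ⟨s, hs⟩ := Module.projective_lifting_property g LinearMap.id hg
    have := id_free hA d hid m
    rw [zero_add]
    refine Retract.hasInjectiveDimensionLT (Y := ModuleCat.of Aᵐᵒᵖ ((Fin m → A) →ₗ[S] S))
      ⟨ModuleCat.ofHom (dA g), ModuleCat.ofHom (dA s), ?_⟩ _
    ext u x
    change u (g (s x)) = u x
    rw [← LinearMap.comp_apply, hs, LinearMap.id_apply]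
  | succ n ih =>
    obtain ⟨m, g, hg⟩ := Module.Finite.exists_fin' A Y
    have hex := LinearMap.exact_subtype_ker_map g
    have hK : Acyc S (LinearMap.ker g) :=
      acyc_ker (f := (LinearMap.ker g).subtype.restrictScalars S) (g := g.restrictScalars S)
        (Submodule.injective_subtype _) hg hex (acyc_free hA m) hY
    have hp : Projective (ModuleCat.of A (Fin m → A)) :=
      (IsProjective.iff_projective (Fin m → A)).1 inferInstance
    have hK1 := ((mk_ses _ g (Submodule.injective_subtype _) hg hex).hasProjectiveDimensionLT_X₃_iff
      n hp).1 h
    have hK2 := ih _ hK hK1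
    obtain ⟨h1, h2, h3⟩ := dA_ses (S := S) (Submodule.injective_subtype _) hg hex hY
    have h4 := (mk_ses _ _ h1 h2 h3).hasInjectiveDimensionLT_X₁ (n+d+1) hK2 
      (have := id_free hA d hid m; hasInjectiveDimensionLT_of_ge _ (d+1) _ (by omega))
    rw [show n + 1 + d + 1 = n + d + 1 + 1 by omega]
    exact h4

lemma bwd [IsNoetherianRing S] [IsLocalRing S] [Module.Finite S A] (hA : Acyc S A) (d : ℕ)
    (hS : HasInjectiveDimensionLT (ModuleCat.of S S) (d+1))
    (rs : List S) (hrs : ∀ r ∈ rs, r ∈ maximalIdeal S) (hreg : IsWeaklyRegular S rs)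
    (hlen : rs.length = d) (n : ℕ)
    (Y : Type) [AddCommGroup Y] [Module S Y] [Module A Y] [IsScalarTower S A Y]
    [Module.Finite A Y] (hY : Acyc S Y)
    (h : HasInjectiveDimensionLT (ModuleCat.of Aᵐᵒᵖ (Y →ₗ[S] S)) (n+d+1)) :
    HasProjectiveDimensionLT (ModuleCat.of A Y) (n+1) := by
  have : IsNoetherianRing A := isNoetherian_of_tower S inferInstance
  have hid := dual_alg_id S A d hS hA
  induction n generalizing Y with
  | zero =>
    obtain ⟨m, g, hg⟩ := Module.Finite.exists_fin' A Y
    have hex := LinearMap.exact_subtype_ker_map g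
    have hK : Acyc S (LinearMap.ker g) :=
      acyc_ker (f := (LinearMap.ker g).subtype.restrictScalars S) (g := g.restrictScalars S)
        (Submodule.injective_subtype _) hg hex (acyc_free hA m) hY
    obtain ⟨h1, h2, h3⟩ := dA_ses (S := S) (Submodule.injective_subtype _) hg hex hY
    have hfY := fin_dual (S := S) (A := A) Y
    have hfK := fin_dual (S := S) (A := A) (LinearMap.ker g)
    have hfinY : Module.Finite S Y := Module.Finite.trans A Y
    have htK := tower_dual (S := S) (A := A) (LinearMap.ker g)
    have hfA : Module.Finite S Aᵐᵒᵖ := Module.Finite.equiv (MulOpposite.opLinearEquiv S)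
    rw [zero_add] at h
    have hext := ext_vanish S Aᵐᵒᵖ (Y →ₗ[S] S) (d+1) h rs hrs ((LinearMap.ker g) →ₗ[S] S)
      (wreg_hom rs S hreg hK) 1 (by omega)
    obtain ⟨ρ, hρ⟩ := ext_extend (mk_ses _ _ h1 h2 h3) (ModuleCat.of Aᵐᵒᵖ (Y →ₗ[S] S)) hext (𝟙 _)
    have hρ : ∀ w : Y →ₗ[S] S, ρ.hom (dA g w) = w := fun w => congrArg (fun k => k.hom w) hρ
    have hsm : ∀ (a : Aᵐᵒᵖ) (w : (Fin m → A) →ₗ[S] S), ρ.hom (a • w) = a • ρ.hom w :=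
      fun a w => ρ.hom.map_smul a w
    have hadd : ∀ (v w : (Fin m → A) →ₗ[S] S), ρ.hom (v + w) = ρ.hom v + ρ.hom w :=
      fun v w => ρ.hom.map_add v w
    have hfinF : Module.Finite S (Fin m → A) := inferInstance
    have bF := eval_bij (d+1) hS (Fin m → A) (acyc_free hA m)
    have bY := eval_bij (d+1) hS Y hY
    have htF := tower_dual (S := S) (A := A) (Fin m → A)
    have htY := tower_dual (S := S) (A := A) Y
    have hsmS : ∀ (a : S) (w : (Fin m → A) →ₗ[S] S), ρ.hom (a • w) = a • ρ.hom w := by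
      intro a w
      rw [← algebraMap_smul Aᵐᵒᵖ a w, hsm]
      exact algebraMap_smul Aᵐᵒᵖ a (ρ.hom w)
    have key : ∀ y : Y, ∃ x : Fin m → A, ∀ u : (Fin m → A) →ₗ[S] S, u x = (ρ.hom u : Y →ₗ[S] S) y := by
      intro y
      let t : ((Fin m → A) →ₗ[S] S) →ₗ[S] S :=
        { toFun := fun u => (ρ.hom u : Y →ₗ[S] S) y
          map_add' := fun v w => by rw [hadd]; rfl
          map_smul' := fun v w => by rw [hsmS]; rfl }
      obtain ⟨x, hx⟩ := bF.2 t
      exact ⟨x, fun u => congrArg (fun k => k u) hx⟩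
    choose s hs using key
    have hinjF : ∀ x x' : Fin m → A, (∀ u : (Fin m → A) →ₗ[S] S, u x = u x') → x = x' :=
      fun x x' hu => bF.1 (LinearMap.ext hu)
    let σ : Y →ₗ[A] (Fin m → A) :=
      { toFun := s
        map_add' := fun y z => hinjF _ _ fun u => by rw [map_add, hs, hs, hs, map_add]
        map_smul' := fun a y => hinjF _ _ fun u => by
          rw [hs, RingHom.id_apply]
          have e1 : u (a • s y) = (MulOpposite.op a • u) (s y) := rfl
          rw [e1, hs, hsm]
          rfl }
    have hσ : g.comp σ = LinearMap.id := by
      ext y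
      refine bY.1 (LinearMap.ext fun w => ?_)
      change w (g (s y)) = w y
      have e1 : w (g (s y)) = (dA g w) (s y) := rfl
      rw [e1, hs, hρ]
    have hproj : Module.Projective A Y := Module.Projective.of_split σ g hσ
    exact projective_iff_hasProjectiveDimensionLT_one.1
      ((IsProjective.iff_projective Y).1 hproj)
  | succ n ih =>
    obtain ⟨m, g, hg⟩ := Module.Finite.exists_fin' A Y
    have hex := LinearMap.exact_subtype_ker_map g
    have hK : Acyc S (LinearMap.ker g) :=
      acyc_ker (f := (LinearMap.ker g).subtype.restrictScalars S) (g := g.restrictScalars S)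
        (Submodule.injective_subtype _) hg hex (acyc_free hA m) hY
    have hp : Projective (ModuleCat.of A (Fin m → A)) :=
      (IsProjective.iff_projective (Fin m → A)).1 inferInstance
    obtain ⟨h1, h2, h3⟩ := dA_ses (S := S) (Submodule.injective_subtype _) hg hex hY
    rw [show n + 1 + d + 1 = n + d + 1 + 1 by omega] at h
    have h4 := (mk_ses _ _ h1 h2 h3).hasInjectiveDimensionLT_X₃ (n+d+1)
      (have := id_free hA d hid m; hasInjectiveDimensionLT_of_ge _ (d+1) _ (by omega)) h
    exact ((mk_ses _ g (Submodule.injective_subtype _) hg hex).hasProjectiveDimensionLT_X₃_iff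
      n hp).2 (ih _ hK h4)

end P6

end Part6

section Part7

open CategoryTheory Abelian Limits
open RingTheory.Sequence IsLocalRing

section P7
variable (S : Type) [CommRing S] (Γ : Type) [Ring Γ] [Algebra S Γ]
  (X : Type) [AddCommGroup X] [Module S X] [Module Γ X] [IsScalarTower S Γ X]

/-- the double opposite -/
def opop : Γ ≃+* Γᵐᵒᵖᵐᵒᵖ := RingEquiv.opOp Γ

attribute [local instance] RingHomInvPair.of_ringEquiv

lemma tower_op : IsScalarTower S Γᵐᵒᵖ (X →ₗ[S] S) := tower_dual X

attribute [local instance] tower_op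

lemma id_ddual (hb : Function.Bijective (Module.Dual.eval S X)) (n : ℕ) :
    HasInjectiveDimensionLT (ModuleCat.of Γ X) (n+1) ↔
    HasInjectiveDimensionLT (ModuleCat.of Γᵐᵒᵖᵐᵒᵖ ((X →ₗ[S] S) →ₗ[S] S)) (n+1) := by
  let e0 : X ≃+ ((X →ₗ[S] S) →ₗ[S] S) :=
    AddEquiv.ofBijective (Module.Dual.eval S X).toAddMonoidHom hb
  let e : X ≃ₛₗ[RingHomClass.toRingHom (RingEquiv.opOp Γ)] ((X →ₗ[S] S) →ₗ[S] S) :=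
    { e0 with map_smul' := fun a x => rfl }
  exact ModuleCat.hasInjectiveDimensionLE_iff_of_semiLinearEquiv (M := ModuleCat.of Γ X)
    (N := ModuleCat.of Γᵐᵒᵖᵐᵒᵖ ((X →ₗ[S] S) →ₗ[S] S)) (RingEquiv.opOp Γ) e n

theorem main_thm
    (S : Type) [CommRing S] [IsNoetherianRing S] [IsLocalRing S]
    (d : ℕ)
    (hdim : ringKrullDim S = d)
    (hGor : ∃ m : ℕ, hasInjDimLE S (ModuleCat.of S S) m)
    (Γ : Type) [Ring Γ] [Algebra S Γ] [Module.Finite S Γ]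
    (hΓMCM : moduleDepth S (ModuleCat.of S Γ) = (d : ℕ∞))
    (X : Type) [AddCommGroup X] [Module S X] [Module Γ X] [IsScalarTower S Γ X]
    [Module.Finite Γ X] [Nontrivial X]
    (hXMCM : moduleDepth S (ModuleCat.of S X) = (d : ℕ∞)) :
    injDim Γ (ModuleCat.of Γ X) =
      projDim Γᵐᵒᵖ (ModuleCat.of Γᵐᵒᵖ (X →ₗ[S] S)) + (d : ℕ∞) := by
  have hntΓ : Nontrivial Γ := by
    by_contra hc
    rw [not_nontrivial_iff_subsingleton] at hc
    exact not_subsingleton X (Module.subsingleton Γ X)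
  have hfX : Module.Finite S X := Module.Finite.trans Γ X
  obtain ⟨m, hm⟩ := hGor
  rw [hasInjDimLE_iff] at hm
  obtain ⟨rs, h1, h2, h3⟩ := bass S _ hm
  obtain ⟨rG, g1, g2, g3⟩ := reg_of_depth S Γ d hΓMCM
  obtain ⟨rX, x1, x2, x3⟩ := reg_of_depth S X d hXMCM
  have hle := reg_len_le S rs h1 h2 d hdim
  have hS : HasInjectiveDimensionLT (ModuleCat.of S S) (d+1) :=
    hasInjectiveDimensionLT_of_ge _ _ (d+1) (Nat.succ_le_succ hle)
  have hG : Acyc S Γ := fun i => ext_vanish S S S (d+1) hS rG g1 Γ g2 (i+1) (by omega)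
  have hX : Acyc S X := fun i => ext_vanish S S S (d+1) hS rX x1 X x2 (i+1) (by omega)
  have hlen : rs.length = d := by
    by_contra hne
    have hS' : HasInjectiveDimensionLT (ModuleCat.of S S) d :=
      hasInjectiveDimensionLT_of_ge _ (rs.length+1) d (by omega)
    have h0 := (hom_sub_iff _ _).1 (ext_vanish S S S d hS' rG g1 Γ g2 0 (by omega))
    have hb := (eval_bij (d+1) hS Γ hG).1
    refine not_subsingleton Γ ⟨fun a b => hb ?_⟩
    ext u
    rw [Subsingleton.elim u 0, map_zero, map_zero]
  have hfD : Module.Finite Γᵐᵒᵖ (X →ₗ[S] S) := fin_dual X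
  have hfop : Module.Finite S Γᵐᵒᵖ := Module.Finite.equiv (MulOpposite.opLinearEquiv S)
  have hAop : Acyc S Γᵐᵒᵖ := fun i =>
    exs_iso (MulOpposite.opLinearEquiv S (M := Γ)).toModuleIso _ _ (hG i)
  have hDX : Acyc S (X →ₗ[S] S) := acyc_dual (d+1) hS X hX
  have hb := eval_bij (d+1) hS X hX
  have hiff : ∀ n : ℕ, hasInjDimLE Γ (ModuleCat.of Γ X) (n+d) ↔
      hasProjDimLE Γᵐᵒᵖ (ModuleCat.of Γᵐᵒᵖ (X →ₗ[S] S)) n := by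
    intro n
    rw [hasInjDimLE_iff, hasProjDimLE_iff, id_ddual S Γ X hb]
    exact ⟨fun h => bwd hAop d hS rs h1 h2 hlen n (X →ₗ[S] S) hDX h,
      fun h => fwd hAop d (dual_alg_id S Γᵐᵒᵖ d hS hAop) n (X →ₗ[S] S) hDX h⟩
  have hge : ∀ m : ℕ, hasInjDimLE Γ (ModuleCat.of Γ X) m → d ≤ m := by
    intro m h
    by_contra hlt
    rw [hasInjDimLE_iff] at h
    have h' : HasInjectiveDimensionLT (ModuleCat.of Γ X) d :=
      hasInjectiveDimensionLT_of_ge _ (m+1) d (by omega)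
    have := sub_of_ext_self (ModuleCat.of Γ X)
      (ext_vanish S Γ X d h' rG g1 Γ g2 0 (by omega))
    exact not_subsingleton X this
  unfold injDim projDim
  apply le_antisymm
  · by_cases hne : ∃ n, hasProjDimLE Γᵐᵒᵖ (ModuleCat.of Γᵐᵒᵖ (X →ₗ[S] S)) n
    · have hne' : {n : ℕ∞ | ∃ m : ℕ, n = (m : ℕ∞) ∧
          hasProjDimLE Γᵐᵒᵖ (ModuleCat.of Γᵐᵒᵖ (X →ₗ[S] S)) m}.Nonempty :=
        hne.elim fun n hn => ⟨n, n, rfl, hn⟩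
      obtain ⟨k, hk1, hk2⟩ := csInf_mem hne'
      rw [hk1]
      exact sInf_le ⟨k + d, by push_cast; rfl, (hiff k).2 hk2⟩
    · have : {n : ℕ∞ | ∃ m : ℕ, n = (m : ℕ∞) ∧
          hasProjDimLE Γᵐᵒᵖ (ModuleCat.of Γᵐᵒᵖ (X →ₗ[S] S)) m} = ∅ := by
        ext n
        simp only [Set.mem_ofPred_eq, Set.mem_empty_iff_false, iff_false]
        rintro ⟨k, -, hk⟩
        exact hne ⟨k, hk⟩
      rw [this, sInf_empty, top_add]
      exact le_top
  · refine le_sInf ?_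
    rintro _ ⟨k, rfl, hk⟩
    obtain ⟨n, rfl⟩ := Nat.exists_eq_add_of_le' (hge k hk)
    push_cast
    gcongr
    exact sInf_le ⟨n, rfl, (hiff n).1 hk⟩
end P7

end Part7

/-- Let `(S, 𝔪)` be a commutative noetherian local Gorenstein ring of
Krull dimension `d`, and let `Γ` be an `S`-algebra, finitely generated and maximal
Cohen–Macaulay as an `S`-module.  For any nonzero finitely generated left `Γ`-module `X`
which is maximal Cohen–Macaulay over `S`, the injective dimension of `X` as a left
`Γ`-module equals the projective dimension of the right `Γ`-module `Hom_S(X, S)` plus `d`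
(an equality in `ℕ∞`). -/
theorem injDim_eq_projDim_dual_add_krullDim
    (S : Type) [CommRing S] [IsNoetherianRing S] [IsLocalRing S]
    (d : ℕ)
    (hdim : ringKrullDim S = d)
    (hGor : ∃ m : ℕ, hasInjDimLE S (ModuleCat.of S S) m)
    (Γ : Type) [Ring Γ] [Algebra S Γ] [Module.Finite S Γ]
    (hΓMCM : moduleDepth S (ModuleCat.of S Γ) = (d : ℕ∞))
    (X : Type) [AddCommGroup X] [Module S X] [Module Γ X] [IsScalarTower S Γ X]
    [Module.Finite Γ X] [Nontrivial X]
    (hXMCM : moduleDepth S (ModuleCat.of S X) = (d : ℕ∞)) :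
    injDim Γ (ModuleCat.of Γ X) =
      projDim Γᵐᵒᵖ (ModuleCat.of Γᵐᵒᵖ (X →ₗ[S] S)) + (d : ℕ∞) := by
  exact main_thm S d hdim hGor Γ hΓMCM X hXMCM
end
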